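/- arXiv:1911.12541 — 2 statements merged into one kernel-verified Lean document; each statement's English description precedes it below -/
import Mathlib

section
/- Let n ≥ 4 be even and let Θ be the graph obtained from the odd cycle v₁v₂⋯v_{n-1}v₁ by adding a new vertex v₀ adjacent to v₂ and v_{n-1}. If G is a nonbipartite 2-connected graph of order n, then q(Θ) ≤ q(G), with equality if and only if G ≅ Θ. -/
open Matrix SimpleGraph
open scoped Classical

/-- The signless Laplacian matrix `Q(G) = D(G) + A(G)` of a simple graph. -/
noncomputable def signlessLaplacian {V : Type*} [Fintype V] (G : SimpleGraph V) :
    Matrix V V ℝ := fun i j =>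
  (if i = j then ((G.neighborSet i).ncard : ℝ) else 0) + (if G.Adj i j then 1 else 0)

/-- The least eigenvalue `q(G)` of the signless Laplacian of `G`. -/
noncomputable def leastQEig {V : Type*} [Fintype V] (G : SimpleGraph V) : ℝ :=
  sInf {μ : ℝ | ∃ x : V → ℝ, x ≠ 0 ∧ (signlessLaplacian G).mulVec x = μ • x}

/-- A graph is 2-connected if it has at least 3 vertices and no cut vertex. -/
def TwoConnected {V : Type*} [Fintype V] (G : SimpleGraph V) : Prop :=
  3 ≤ Fintype.card V ∧
    ∀ v : V, (((⊤ : G.Subgraph).deleteVerts {v}).coe).Connected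

/-- The cycle `C_n` on vertices `v_0, …, v_{n-1}`. -/
def cycleG (n : ℕ) : SimpleGraph (Fin n) :=
  SimpleGraph.fromRel (fun i j => (i.val + 1) % n = j.val)

/-- `H(i₁,…,i_k)`: the cycle `C_n` together with the chords `v_i v_{n-i}` for `i ∈ S`. -/
def Hgraph (n : ℕ) (S : Finset ℕ) : SimpleGraph (Fin n) :=
  cycleG n ⊔ SimpleGraph.fromRel (fun a b => ∃ i ∈ S, a.val = i ∧ b.val = n - i)

/-- `Θ(j,k)`: the odd cycle `v₁v₂⋯v_{n-1}v₁` plus a vertex `v₀` adjacent to `v_j` and `v_k`. -/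
def thetaJK (n j k : ℕ) : SimpleGraph (Fin n) :=
  SimpleGraph.fromRel (fun a b =>
    (1 ≤ a.val ∧ b.val = a.val + 1) ∨ (a.val = 1 ∧ b.val = n - 1) ∨
      (a.val = 0 ∧ (b.val = j ∨ b.val = k)))

/-- The graph `Θ = Θ(2, n-1)`. -/
def thetaG (n : ℕ) : SimpleGraph (Fin n) := thetaJK n 2 (n - 1)


/-- A nonnegative quadratic polynomial vanishing at zero has no linear term. -/
lemma lin_zero {A B : ℝ} (h : ∀ ε : ℝ, 0 ≤ A * ε ^ 2 + B * ε) : B = 0 := by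
  by_contra hB
  have hpos : 0 < |A| + 1 := by positivity
  have h1 := h (-B / (|A| + 1))
  have h2 : A * (-B / (|A| + 1)) ^ 2 + B * (-B / (|A| + 1))
      = B ^ 2 * (A - (|A| + 1)) / (|A| + 1) ^ 2 := by
    field_simp
    ring
  rw [h2] at h1
  have h3 : 0 < B ^ 2 := by positivity
  have h4 : A - (|A| + 1) < 0 := by linarith [le_abs_self A]
  have h5 : B ^ 2 * (A - (|A| + 1)) / (|A| + 1) ^ 2 < 0 :=
    div_neg_of_neg_of_pos (mul_neg_of_pos_of_neg h3 h4) (by positivity)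
  linarith

section Spectral
variable {V : Type*} [Fintype V]

/-- Twice the signless Laplacian quadratic form. -/
noncomputable def qf (G : SimpleGraph V) (y : V → ℝ) : ℝ :=
  ∑ u, ∑ v, if G.Adj u v then (y u + y v) ^ 2 else 0

/-- The polar form. -/
noncomputable def qb (G : SimpleGraph V) (y z : V → ℝ) : ℝ :=
  ∑ u, ∑ v, if G.Adj u v then (y u + y v) * (z u + z v) else 0

lemma mulVec_eq (G : SimpleGraph V) (y : V → ℝ) (u : V) :
    (signlessLaplacian G).mulVec y u = ∑ v, if G.Adj u v then (y u + y v) else 0 := by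
  simp only [Matrix.mulVec, dotProduct, signlessLaplacian]
  have h1 : ((G.neighborSet u).ncard : ℝ) = ∑ v, if G.Adj u v then (1 : ℝ) else 0 := by
    rw [Set.ncard_eq_toFinset_card', Finset.sum_boole]
    congr 2
    ext v
    simp
  simp only [add_mul, Finset.sum_add_distrib, ite_mul, zero_mul, one_mul, Finset.sum_ite_eq,
    Finset.mem_univ, if_true]
  rw [h1, Finset.sum_mul, ← Finset.sum_add_distrib]
  refine Finset.sum_congr rfl fun v _ => ?_
  split_ifs <;> ring

lemma qb_eq (G : SimpleGraph V) (y z : V → ℝ) :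
    qb G y z = 2 * ∑ u, z u * (signlessLaplacian G).mulVec y u := by
  simp only [mulVec_eq, qb]
  have h1 : ∀ u v, (if G.Adj u v then (y u + y v) * (z u + z v) else 0)
      = z u * (if G.Adj u v then (y u + y v) else 0)
        + z v * (if G.Adj v u then (y v + y u) else 0) := by
    intro u v
    by_cases h : G.Adj u v
    · simp only [h, h.symm, if_true]; ring
    · have h' : ¬ G.Adj v u := fun h' => h h'.symm
      simp [h, h']
  simp only [h1, Finset.sum_add_distrib]
  rw [Finset.sum_comm (f := fun u v => z v * (if G.Adj v u then (y v + y u) else 0))]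
  simp only [Finset.mul_sum]
  rw [← two_mul, Finset.mul_sum]
  simp only [Finset.mul_sum]

lemma qf_add (G : SimpleGraph V) (y z : V → ℝ) (ε : ℝ) :
    qf G (fun u => y u + ε * z u) = qf G y + 2 * ε * qb G y z + ε ^ 2 * qf G z := by
  simp only [qf, qb, Finset.mul_sum, ← Finset.sum_add_distrib]
  refine Finset.sum_congr rfl fun u _ => Finset.sum_congr rfl fun v _ => ?_
  split_ifs <;> ring

lemma qf_smul (G : SimpleGraph V) (y : V → ℝ) (c : ℝ) :
    qf G (fun u => c * y u) = c ^ 2 * qf G y := by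
  simp only [qf, Finset.mul_sum]
  refine Finset.sum_congr rfl fun u _ => Finset.sum_congr rfl fun v _ => ?_
  split_ifs <;> ring

lemma qf_nonneg (G : SimpleGraph V) (y : V → ℝ) : 0 ≤ qf G y := by
  refine Finset.sum_nonneg fun u _ => Finset.sum_nonneg fun v _ => ?_
  split_ifs <;> positivity

lemma qf_eigen (G : SimpleGraph V) (y : V → ℝ) (μ : ℝ)
    (h : (signlessLaplacian G).mulVec y = μ • y) : qf G y = 2 * (μ * ∑ u, y u ^ 2) := by
  have h1 : qf G y = qb G y y := by
    simp only [qf, qb]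
    refine Finset.sum_congr rfl fun u _ => Finset.sum_congr rfl fun v _ => ?_
    split_ifs <;> ring
  rw [h1, qb_eq, h]
  simp only [Pi.smul_apply, smul_eq_mul, Finset.mul_sum]
  refine Finset.sum_congr rfl fun u _ => ?_
  ring

lemma exists_min [Nonempty V] (G : SimpleGraph V) :
    ∃ (m : ℝ) (x : V → ℝ), x ≠ 0 ∧ (signlessLaplacian G).mulVec x = m • x ∧
      ∀ y, 2 * (m * ∑ u, y u ^ 2) ≤ qf G y := by
  let K : Set (V → ℝ) := {y | ∑ u, y u ^ 2 = 1}
  have hclosed : IsClosed K := by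
    apply isClosed_eq
    · fun_prop
    · fun_prop
  have hK : IsCompact K := by
    refine (isCompact_univ_pi (fun _ : V => isCompact_Icc (a := (-1 : ℝ)) (b := 1))).of_isClosed_subset
      hclosed ?_
    intro y hy u _
    have h1 : y u ^ 2 ≤ 1 := by
      rw [← show ∑ u, y u ^ 2 = 1 from hy]
      exact Finset.single_le_sum (f := fun u => y u ^ 2) (fun i _ => sq_nonneg _) (Finset.mem_univ u)
    exact abs_le.mp ((sq_le_one_iff_abs_le_one _).mp h1)
  have hne : K.Nonempty := by
    obtain ⟨v⟩ := ‹Nonempty V›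
    refine ⟨fun u => if u = v then 1 else 0, ?_⟩
    simp [K]
  have hcont : Continuous (qf G) := by
    unfold qf
    refine continuous_finsetSum _ fun u _ => continuous_finsetSum _ fun v _ => ?_
    split_ifs <;> fun_prop
  obtain ⟨x, hx, hmin⟩ := hK.exists_isMinOn hne hcont.continuousOn
  have hx1 : ∑ u, x u ^ 2 = 1 := hx
  have hall : ∀ y, qf G x * ∑ u, y u ^ 2 ≤ qf G y := by
    intro y
    by_cases hy : ∑ u, y u ^ 2 = 0
    · rw [hy, mul_zero]; exact qf_nonneg G y
    have hpos : 0 < ∑ u, y u ^ 2 :=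
      lt_of_le_of_ne (Finset.sum_nonneg fun i _ => sq_nonneg _) (Ne.symm hy)
    set S := ∑ u, y u ^ 2 with hS
    have hmem : (fun u => (Real.sqrt S)⁻¹ * y u) ∈ K := by
      show ∑ u, ((Real.sqrt S)⁻¹ * y u) ^ 2 = 1
      simp only [mul_pow, ← Finset.mul_sum, ← hS, inv_pow, Real.sq_sqrt hpos.le]
      exact inv_mul_cancel₀ hy
    have h2 : qf G x ≤ qf G (fun u => (Real.sqrt S)⁻¹ * y u) := hmin hmem
    rw [qf_smul, inv_pow, Real.sq_sqrt hpos.le] at h2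
    calc qf G x * S ≤ (S⁻¹ * qf G y) * S := by gcongr
      _ = qf G y := by field_simp
  refine ⟨qf G x / 2, x, ?_, ?_, ?_⟩
  · rintro rfl
    simp at hx1
  · have hz : ∀ z, 2 * qb G x z - 2 * qf G x * ∑ u, x u * z u = 0 := by
      intro z
      apply lin_zero (A := qf G z - qf G x * ∑ u, z u ^ 2)
      intro ε
      have h1 := hall (fun u => x u + ε * z u)
      rw [qf_add] at h1
      have h2 : ∑ u, (x u + ε * z u) ^ 2
          = ∑ u, x u ^ 2 + 2 * ε * ∑ u, x u * z u + ε ^ 2 * ∑ u, z u ^ 2 := by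
        simp only [Finset.mul_sum, ← Finset.sum_add_distrib]
        refine Finset.sum_congr rfl fun u _ => ?_
        ring
      rw [h2, hx1] at h1
      linarith
    funext v
    have h3 := hz (fun u => if u = v then 1 else 0)
    rw [qb_eq] at h3
    simp only [ite_mul, one_mul, zero_mul, mul_ite, mul_one, mul_zero, Finset.sum_ite_eq',
      Finset.mem_univ, if_true] at h3
    simp only [Pi.smul_apply, smul_eq_mul]
    linarith
  · intro y
    have := hall y
    linarith

lemma least_spec [Nonempty V] (G : SimpleGraph V) :
    (∃ x : V → ℝ, x ≠ 0 ∧ (signlessLaplacian G).mulVec x = leastQEig G • x) ∧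
      ∀ y, 2 * (leastQEig G * ∑ u, y u ^ 2) ≤ qf G y := by
  obtain ⟨m, x, hx0, hx, hm⟩ := exists_min G
  have : leastQEig G = m := by
    apply IsLeast.csInf_eq
    refine ⟨⟨x, hx0, hx⟩, ?_⟩
    rintro μ ⟨z, hz0, hz⟩
    have h1 := hm z
    rw [qf_eigen G z μ hz] at h1
    have hpos : 0 < ∑ u, z u ^ 2 := by
      obtain ⟨u, hu⟩ := Function.ne_iff.mp hz0
      refine Finset.sum_pos' (fun i _ => sq_nonneg _) ⟨u, Finset.mem_univ u, ?_⟩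
      have : z u ≠ 0 := hu
      positivity
    by_contra hlt
    push Not at hlt
    nlinarith
  rw [this]
  exact ⟨⟨x, hx0, hx⟩, hm⟩

lemma least_iso {W : Type*} [Fintype W] (G : SimpleGraph V) (H : SimpleGraph W) (f : G ≃g H) :
    leastQEig G = leastQEig H := by
  unfold leastQEig
  congr 1
  ext μ
  constructor
  · rintro ⟨x, hx0, hx⟩
    refine ⟨fun w => x (f.symm w), ?_, ?_⟩
    · intro h
      apply hx0
      funext v
      have := congrFun h (f v)
      simpa using this
    · funext w
      have h1 := congrFun hx (f.symm w)
      rw [mulVec_eq] at h1 ⊢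
      simp only [Pi.smul_apply] at h1 ⊢
      rw [← h1]
      rw [← f.symm.toEquiv.sum_comp]
      refine Finset.sum_congr rfl fun v _ => ?_
      have : G.Adj (f.symm w) (f.symm v) ↔ H.Adj w v := f.symm.map_adj_iff
      simp [this]
  · rintro ⟨x, hx0, hx⟩
    refine ⟨fun w => x (f w), ?_, ?_⟩
    · intro h
      apply hx0
      funext v
      have := congrFun h (f.symm v)
      simpa using this
    · funext w
      have h1 := congrFun hx (f w)
      rw [mulVec_eq] at h1 ⊢
      simp only [Pi.smul_apply] at h1 ⊢
      rw [← h1]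
      rw [← f.toEquiv.sum_comp]
      refine Finset.sum_congr rfl fun v _ => ?_
      have : H.Adj (f w) (f v) ↔ G.Adj w v := f.map_adj_iff
      simp [this]

end Spectral


/-- Test vector on the theta graph. -/
noncomputable def tvec (q : ℕ) (L R : ℕ → ℝ) (u t : ℝ) (k : ℕ) : ℝ :=
  if k = 0 then -t else if k = 1 then -u else
    if k ≤ q + 2 then (-1) ^ k * L (q + 2 - k) else (-1) ^ (k + 1) * R (k - (q + 3))

lemma qf_theta_le (q : ℕ) (y : ℕ → ℝ) :
    qf (thetaG (2 * q + 4)) (fun i => y i.val) ≤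
      2 * (∑ k ∈ Finset.range (2 * q + 2), (y (k + 1) + y (k + 2)) ^ 2
        + (y 1 + y (2 * q + 3)) ^ 2 + (y 0 + y 2) ^ 2 + (y 0 + y (2 * q + 3)) ^ 2) := by
  set n := 2 * q + 4 with hn
  let r : ℕ → ℕ → Prop := fun a b => (1 ≤ a ∧ b = a + 1) ∨ (a = 1 ∧ b = n - 1) ∨
      (a = 0 ∧ (b = 2 ∨ b = n - 1))
  let f : ℕ → ℕ → ℝ := fun a b => if r a b then (y a + y b) ^ 2 else 0
  have hf0 : ∀ a b, 0 ≤ f a b := by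
    intro a b; simp only [f]; split_ifs <;> positivity
  have h1 : qf (thetaG n) (fun i => y i.val) ≤ ∑ a : Fin n, ∑ b : Fin n, (f a b + f b a) := by
    unfold qf
    refine Finset.sum_le_sum fun a _ => Finset.sum_le_sum fun b _ => ?_
    split_ifs with h
    · have h' : r a b ∨ r b a := by
        simp only [thetaG, thetaJK, SimpleGraph.fromRel_adj] at h
        exact h.2
      rcases h' with h' | h'
      · have : f a b = (y a + y b) ^ 2 := by simp [f, h']
        linarith [hf0 b a]
      · have : f b a = (y b + y a) ^ 2 := by simp [f, h']
        have h3 := hf0 a b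
        rw [this]; nlinarith
    · linarith [hf0 a b, hf0 b a]
  have h2 : ∑ a : Fin n, ∑ b : Fin n, (f a b + f b a) = 2 * ∑ a ∈ Finset.range n, ∑ b ∈ Finset.range n, f a b := by
    simp only [Finset.sum_add_distrib]
    rw [Finset.sum_comm (f := fun a b : Fin n => f b a), ← two_mul]
    congr 1
    rw [← Fin.sum_univ_eq_sum_range (fun a => ∑ b ∈ Finset.range n, f a b)]
    refine Finset.sum_congr rfl fun a _ => ?_
    rw [← Fin.sum_univ_eq_sum_range (fun b => f a b)]
  have h3 : ∀ a ∈ Finset.range n, ∀ b ∈ Finset.range n, f a b ≤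
      (if b = a + 1 then (if 1 ≤ a then (y a + y (a + 1)) ^ 2 else 0) else 0)
      + (if b = n - 1 then (if a = 1 then (y 1 + y (n - 1)) ^ 2 else 0) else 0)
      + (if b = 2 then (if a = 0 then (y 0 + y 2) ^ 2 else 0) else 0)
      + (if b = n - 1 then (if a = 0 then (y 0 + y (n - 1)) ^ 2 else 0) else 0) := by
    intro a _ b _
    have g1 : 0 ≤ (if b = a + 1 then (if 1 ≤ a then (y a + y (a + 1)) ^ 2 else 0) else 0) := by
      split_ifs <;> positivity
    have g2 : 0 ≤ (if b = n - 1 then (if a = 1 then (y 1 + y (n - 1)) ^ 2 else 0) else 0) := by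
      split_ifs <;> positivity
    have g3 : 0 ≤ (if b = 2 then (if a = 0 then (y 0 + y 2) ^ 2 else 0) else 0) := by
      split_ifs <;> positivity
    have g4 : 0 ≤ (if b = n - 1 then (if a = 0 then (y 0 + y (n - 1)) ^ 2 else 0) else 0) := by
      split_ifs <;> positivity
    by_cases h : r a b
    · have hfab : f a b = (y a + y b) ^ 2 := by simp [f, h]
      rw [hfab]
      rcases h with ⟨h, h'⟩ | ⟨h, h'⟩ | ⟨h, h' | h'⟩
      · have : (if b = a + 1 then (if 1 ≤ a then (y a + y (a + 1)) ^ 2 else 0) else 0) = (y a + y b) ^ 2 := by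
          rw [if_pos h', if_pos h, h']
        linarith
      · have : (if b = n - 1 then (if a = 1 then (y 1 + y (n - 1)) ^ 2 else 0) else 0) = (y a + y b) ^ 2 := by
          rw [if_pos h', if_pos h, h', h]
        linarith
      · have : (if b = 2 then (if a = 0 then (y 0 + y 2) ^ 2 else 0) else 0) = (y a + y b) ^ 2 := by
          rw [if_pos h', if_pos h, h', h]
        linarith
      · have : (if b = n - 1 then (if a = 0 then (y 0 + y (n - 1)) ^ 2 else 0) else 0) = (y a + y b) ^ 2 := by
          rw [if_pos h', if_pos h, h', h]
        linarith
    · have hfab : f a b = 0 := by simp [f, h]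
      rw [hfab]; linarith
  have h4 := Finset.sum_le_sum fun a ha => Finset.sum_le_sum (h3 a ha)
  have hn1 : n - 1 = 2 * q + 3 := by omega
  simp only [Finset.sum_add_distrib, Finset.sum_ite_eq', Finset.mem_range] at h4
  have e1 : ∑ a ∈ Finset.range n, (if a + 1 < n then (if 1 ≤ a then (y a + y (a + 1)) ^ 2 else 0) else 0)
      = ∑ k ∈ Finset.range (2 * q + 2), (y (k + 1) + y (k + 2)) ^ 2 := by
    rw [hn, show 2 * q + 4 = (2 * q + 2) + 1 + 1 from rfl, Finset.sum_range_succ, Finset.sum_range_succ']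
    simp only [lt_irrefl, if_false, add_zero, zero_add]
    rw [if_neg (by omega : ¬ (1 ≤ 0))]
    simp only [ite_self, add_zero]
    refine Finset.sum_congr rfl fun k hk => ?_
    rw [Finset.mem_range] at hk
    rw [if_pos (by omega), if_pos (by omega)]
  rw [e1] at h4
  have c1 : n - 1 < n := by omega
  have c2 : 2 < n := by omega
  have c3 : 1 < n := by omega
  have c4 : 0 < n := by omega
  simp only [c1, c2, if_true, Finset.sum_ite_eq', Finset.mem_range, c3, c4] at h4
  rw [hn1] at h4
  linarith

lemma theta_test (q : ℕ) (L R : ℕ → ℝ) (u t : ℝ) :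
    leastQEig (thetaG (2 * q + 4)) * (∑ j ∈ Finset.range (q + 1), (L j ^ 2 + R j ^ 2) + u ^ 2 + t ^ 2) ≤
      (L 0 + R 0) ^ 2 + ∑ j ∈ Finset.range q, ((L (j + 1) - L j) ^ 2 + (R (j + 1) - R j) ^ 2)
        + (u - L q) ^ 2 + (u - R q) ^ 2 + (t - L q) ^ 2 + (t - R q) ^ 2 := by
  set y := tvec q L R u t with hy
  have hne : Nonempty (Fin (2 * q + 4)) := ⟨⟨0, by omega⟩⟩
  have h1 := (least_spec (thetaG (2 * q + 4))).2 (fun i => y i.val)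
  have h2 := qf_theta_le q y
  have y0 : y 0 = -t := by simp [hy, tvec]
  have y1 : y 1 = -u := by simp [hy, tvec]
  have yL : ∀ j, j ≤ q → y (q + 2 - j) = (-1) ^ (q + 2 - j) * L j := by
    intro j hj
    simp only [hy, tvec]
    rw [if_neg (by omega), if_neg (by omega), if_pos (by omega)]
    congr 2
    omega
  have yR : ∀ j, y (q + 3 + j) = (-1) ^ (q + 3 + j + 1) * R j := by
    intro j
    simp only [hy, tvec]
    rw [if_neg (by omega), if_neg (by omega), if_neg (by omega)]
    congr 2
    omega
  have sgn : ∀ k : ℕ, ((-1 : ℝ) ^ k) ^ 2 = 1 := by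
    intro k; rw [← pow_mul, mul_comm, pow_mul]; norm_num
  have hm : ∑ i : Fin (2 * q + 4), y i.val ^ 2
      = ∑ j ∈ Finset.range (q + 1), (L j ^ 2 + R j ^ 2) + u ^ 2 + t ^ 2 := by
    rw [Fin.sum_univ_eq_sum_range (fun i => y i ^ 2), show 2 * q + 4 = ((q + 1) + (q + 1) + 1) + 1 by ring,
      Finset.sum_range_succ', Finset.sum_range_succ', y0, y1, Finset.sum_range_add, Finset.sum_add_distrib]
    have a1 : ∑ x ∈ Finset.range (q + 1), y (x + 1 + 1) ^ 2 = ∑ x ∈ Finset.range (q + 1), L x ^ 2 := by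
      rw [← Finset.sum_range_reflect]
      refine Finset.sum_congr rfl fun j hj => ?_
      rw [Finset.mem_range] at hj
      rw [show q + 1 - 1 - j + 1 + 1 = q + 2 - j by omega, yL j (by omega), mul_pow, sgn, one_mul]
    have a2 : ∑ x ∈ Finset.range (q + 1), y (q + 1 + x + 1 + 1) ^ 2 = ∑ x ∈ Finset.range (q + 1), R x ^ 2 := by
      refine Finset.sum_congr rfl fun j hj => ?_
      rw [show q + 1 + j + 1 + 1 = q + 3 + j by omega, yR j, mul_pow, sgn, one_mul]
    rw [a1, a2]
    ring
  have ytop : y (2 * q + 3) = R q := by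
    rw [show 2 * q + 3 = q + 3 + q by ring, yR, show q + 3 + q + 1 = 2 * (q + 2) by ring, pow_mul]
    norm_num
  have y2 : y 2 = L q := by
    have := yL q le_rfl
    rw [show q + 2 - q = 2 by omega] at this
    rw [this]; norm_num
  have hs : ∑ k ∈ Finset.range (2 * q + 2), (y (k + 1) + y (k + 2)) ^ 2
      = (u - L q) ^ 2 + ∑ j ∈ Finset.range q, ((L (j + 1) - L j) ^ 2 + (R (j + 1) - R j) ^ 2) + (L 0 + R 0) ^ 2 := by
    rw [show 2 * q + 2 = (q + (1 + q)) + 1 by ring, Finset.sum_range_succ', Finset.sum_range_add,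
      Finset.sum_range_add, Finset.sum_add_distrib]
    have a1 : ∑ x ∈ Finset.range q, (y (x + 1 + 1) + y (x + 1 + 2)) ^ 2
        = ∑ j ∈ Finset.range q, (L (j + 1) - L j) ^ 2 := by
      rw [← Finset.sum_range_reflect]
      refine Finset.sum_congr rfl fun j hj => ?_
      rw [Finset.mem_range] at hj
      rw [show q - 1 - j + 1 + 1 = q + 2 - (j + 1) by omega, show q - 1 - j + 1 + 2 = q + 2 - j by omega,
        yL j (by omega), yL (j + 1) (by omega), show q + 2 - j = (q + 2 - (j + 1)) + 1 by omega, pow_succ _ (q + 2 - (j + 1))]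
      rw [show ∀ s a b : ℝ, (s * a + s * (-1) * b) ^ 2 = s ^ 2 * (a - b) ^ 2 by intros; ring, sgn, one_mul]
    have a2 : ∑ x ∈ Finset.range q, (y (q + (1 + x) + 1 + 1) + y (q + (1 + x) + 1 + 2)) ^ 2
        = ∑ j ∈ Finset.range q, (R (j + 1) - R j) ^ 2 := by
      refine Finset.sum_congr rfl fun j hj => ?_
      rw [show q + (1 + j) + 1 + 1 = q + 3 + j by omega, show q + (1 + j) + 1 + 2 = q + 3 + (j + 1) by omega,
        yR, yR, show q + 3 + (j + 1) + 1 = (q + 3 + j + 1) + 1 by omega, pow_succ _ (q + 3 + j + 1)]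
      rw [show ∀ s a b : ℝ, (s * a + s * (-1) * b) ^ 2 = s ^ 2 * (b - a) ^ 2 by intros; ring, sgn, one_mul]
    have a3 : (y (q + 1 + 1) + y (q + 1 + 2)) ^ 2 = (L 0 + R 0) ^ 2 := by
      have e := yL 0 (by omega)
      have e' := yR 0
      rw [Nat.sub_zero] at e
      rw [show q + 1 + 1 = q + 2 by omega, show q + 1 + 2 = q + 3 + 0 by omega, e, e',
        show q + 3 + 0 + 1 = q + 2 + 2 by omega, pow_add _ (q + 2) 2]
      rw [show ∀ s a b : ℝ, (s * a + s * (-1) ^ 2 * b) ^ 2 = s ^ 2 * (a + b) ^ 2 by intros; ring, sgn, one_mul]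
    rw [a1, a2]
    simp only [Finset.range_one, Finset.sum_singleton, add_zero, zero_add, a3, y1, y2]
    ring
  rw [hs, y0, y1, y2, ytop] at h2
  rw [hm] at h1
  nlinarith


/-- Right hand side of the theta test inequality. -/
noncomputable def trhs (q : ℕ) (L R : ℕ → ℝ) (u t : ℝ) : ℝ :=
  (L 0 + R 0) ^ 2 + ∑ j ∈ Finset.range q, ((L (j + 1) - L j) ^ 2 + (R (j + 1) - R j) ^ 2)
        + (u - L q) ^ 2 + (u - R q) ^ 2 + (t - L q) ^ 2 + (t - R q) ^ 2

/-- Mass in the theta test inequality. -/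
noncomputable def tmass (q : ℕ) (L R : ℕ → ℝ) (u t : ℝ) : ℝ :=
  ∑ j ∈ Finset.range (q + 1), (L j ^ 2 + R j ^ 2) + u ^ 2 + t ^ 2

lemma trhs_par (q : ℕ) (L R L' R' : ℕ → ℝ) (u t u' t' : ℝ) :
    trhs q (fun j => L j + L' j) (fun j => R j + R' j) (u + u') (t + t')
      + trhs q (fun j => L j - L' j) (fun j => R j - R' j) (u - u') (t - t')
      = 2 * trhs q L R u t + 2 * trhs q L' R' u' t' := by
  have h : ∑ j ∈ Finset.range q, ((L (j + 1) + L' (j + 1) - (L j + L' j)) ^ 2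
        + (R (j + 1) + R' (j + 1) - (R j + R' j)) ^ 2)
      + ∑ j ∈ Finset.range q, ((L (j + 1) - L' (j + 1) - (L j - L' j)) ^ 2
        + (R (j + 1) - R' (j + 1) - (R j - R' j)) ^ 2)
      = 2 * ∑ j ∈ Finset.range q, ((L (j + 1) - L j) ^ 2 + (R (j + 1) - R j) ^ 2)
      + 2 * ∑ j ∈ Finset.range q, ((L' (j + 1) - L' j) ^ 2 + (R' (j + 1) - R' j) ^ 2) := by
    simp only [Finset.mul_sum, ← Finset.sum_add_distrib]
    refine Finset.sum_congr rfl fun j _ => ?_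
    ring
  simp only [trhs]
  linear_combination h

lemma tmass_par (q : ℕ) (L R L' R' : ℕ → ℝ) (u t u' t' : ℝ) :
    tmass q (fun j => L j + L' j) (fun j => R j + R' j) (u + u') (t + t')
      + tmass q (fun j => L j - L' j) (fun j => R j - R' j) (u - u') (t - t')
      = 2 * tmass q L R u t + 2 * tmass q L' R' u' t' := by
  have h : ∑ j ∈ Finset.range (q + 1), ((L j + L' j) ^ 2 + (R j + R' j) ^ 2)
      + ∑ j ∈ Finset.range (q + 1), ((L j - L' j) ^ 2 + (R j - R' j) ^ 2)
      = 2 * ∑ j ∈ Finset.range (q + 1), (L j ^ 2 + R j ^ 2)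
      + 2 * ∑ j ∈ Finset.range (q + 1), (L' j ^ 2 + R' j ^ 2) := by
    simp only [Finset.mul_sum, ← Finset.sum_add_distrib]
    refine Finset.sum_congr rfl fun j _ => ?_
    ring
  simp only [tmass]
  linear_combination h

/-- Increments of a sequence. -/
noncomputable def inc (β : ℕ → ℝ) (j : ℕ) : ℝ := if j = 0 then β 0 else β j - β (j - 1)

/-- Weights of the paired form. -/
noncomputable def wt (q j : ℕ) : ℝ := if j = 0 ∨ j = q + 1 then 4 else 2

lemma wt_pos (q j : ℕ) : 0 < wt q j := by
  unfold wt; split_ifs <;> norm_num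

lemma paired_rhs (q : ℕ) (β : ℕ → ℝ) :
    trhs q β β (β (q + 1)) (β (q + 1)) = ∑ j ∈ Finset.range (q + 2), wt q j * inc β j ^ 2 := by
  rw [Finset.sum_range_succ, Finset.sum_range_succ']
  have h : ∑ k ∈ Finset.range q, wt q (k + 1) * inc β (k + 1) ^ 2
      = ∑ j ∈ Finset.range q, ((β (j + 1) - β j) ^ 2 + (β (j + 1) - β j) ^ 2) := by
    refine Finset.sum_congr rfl fun j hj => ?_
    rw [Finset.mem_range] at hj
    simp only [wt, inc]
    rw [if_neg (by omega), if_neg (by omega), Nat.add_sub_cancel]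
    ring
  rw [h]
  simp only [wt, inc, trhs]
  simp
  ring

lemma paired_mass (q : ℕ) (β : ℕ → ℝ) :
    tmass q β β (β (q + 1)) (β (q + 1)) = 2 * ∑ j ∈ Finset.range (q + 2), β j ^ 2 := by
  rw [Finset.sum_range_succ, tmass, Finset.sum_add_distrib]
  ring


/-- The test inequality as a property. -/
def TestIneq (q : ℕ) (lam : ℝ) : Prop :=
  ∀ (L R : ℕ → ℝ) (u t : ℝ), lam * tmass q L R u t ≤ trhs q L R u t

lemma T2 {q : ℕ} {lam : ℝ} (hT : TestIneq q lam) (β : ℕ → ℝ) :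
    2 * lam * ∑ j ∈ Finset.range (q + 2), β j ^ 2
      ≤ ∑ j ∈ Finset.range (q + 2), wt q j * inc β j ^ 2 := by
  have := hT β β (β (q + 1)) (β (q + 1))
  rw [paired_rhs, paired_mass] at this
  linarith

lemma lam_le_one {q : ℕ} {lam : ℝ} (hT : TestIneq q lam) : lam ≤ 1 := by
  have h := hT (fun _ => 1) (fun _ => 1) 1 1
  simp only [tmass, trhs] at h
  norm_num at h
  have hq : (0 : ℝ) ≤ q := Nat.cast_nonneg q
  by_contra hl
  push Not at hl
  nlinarith

lemma T2_eq {q : ℕ} {lam : ℝ} (hT : TestIneq q lam) (β : ℕ → ℝ)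
    (he : ∑ j ∈ Finset.range (q + 2), wt q j * inc β j ^ 2
      ≤ 2 * lam * ∑ j ∈ Finset.range (q + 2), β j ^ 2) (i : ℕ) (hi : i < q + 2) :
    wt q i * inc β i = 2 * lam * ∑ j ∈ Finset.range (q + 2), if i ≤ j then β j else 0 := by
  have key : 2 * (wt q i * inc β i - 2 * lam * ∑ j ∈ Finset.range (q + 2), if i ≤ j then β j else 0) = 0 := by
    let γ : ℕ → ℝ := fun j => if i ≤ j then 1 else 0
    apply lin_zero (A := ∑ j ∈ Finset.range (q + 2), wt q j * inc γ j ^ 2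
      - 2 * lam * ∑ j ∈ Finset.range (q + 2), γ j ^ 2)
    intro ε
    have h := T2 hT (fun j => β j + ε * γ j)
    have hinc : ∀ j, inc (fun j => β j + ε * γ j) j = inc β j + ε * inc γ j := by
      intro j; simp only [inc]; split_ifs <;> ring
    have hincg : ∀ j, inc γ j = if j = i then 1 else 0 := by
      intro j
      simp only [inc, γ]
      rcases Nat.eq_zero_or_pos j with hj | hj
      · subst hj
        simp [eq_comm]
      · rw [if_neg (by omega)]
        rcases lt_trichotomy j i with h | h | h
        · rw [if_neg (by omega), if_neg (by omega), if_neg (by omega)]; ring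
        · rw [if_pos (by omega), if_neg (by omega), if_pos h]; ring
        · rw [if_pos (by omega), if_pos (by omega), if_neg (by omega)]; ring
    have e1 : ∑ j ∈ Finset.range (q + 2), (β j + ε * γ j) ^ 2
        = ∑ j ∈ Finset.range (q + 2), β j ^ 2
          + 2 * ε * ∑ j ∈ Finset.range (q + 2), (if i ≤ j then β j else 0)
          + ε ^ 2 * ∑ j ∈ Finset.range (q + 2), γ j ^ 2 := by
      simp only [Finset.mul_sum, ← Finset.sum_add_distrib]
      refine Finset.sum_congr rfl fun j _ => ?_
      simp only [γ]; split_ifs <;> ring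
    have e2 : ∑ j ∈ Finset.range (q + 2), wt q j * inc (fun j => β j + ε * γ j) j ^ 2
        = ∑ j ∈ Finset.range (q + 2), wt q j * inc β j ^ 2
          + 2 * ε * (wt q i * inc β i)
          + ε ^ 2 * ∑ j ∈ Finset.range (q + 2), wt q j * inc γ j ^ 2 := by
      have : wt q i * inc β i = ∑ j ∈ Finset.range (q + 2), if j = i then wt q j * inc β j else 0 := by
        rw [Finset.sum_ite_eq', if_pos (Finset.mem_range.mpr hi)]
      rw [this]
      simp only [Finset.mul_sum, ← Finset.sum_add_distrib]
      refine Finset.sum_congr rfl fun j _ => ?_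
      rw [hinc, hincg]; split_ifs <;> ring
    rw [e1, e2] at h
    nlinarith
  linarith

lemma T2_zero {q : ℕ} {lam : ℝ} (hT : TestIneq q lam) (β : ℕ → ℝ)
    (he : ∑ j ∈ Finset.range (q + 2), wt q j * inc β j ^ 2
      ≤ 2 * lam * ∑ j ∈ Finset.range (q + 2), β j ^ 2) (h0 : β (q + 1) = 0) :
    ∀ j, j ≤ q + 1 → β j = 0 := by
  have key : ∀ k, k ≤ q + 1 → ∀ j, q + 1 - k ≤ j → j ≤ q + 1 → β j = 0 := by
    intro k
    induction k with
    | zero =>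
      intro _ j h1 h2
      have : j = q + 1 := by omega
      rw [this, h0]
    | succ k ih =>
      intro hk j h1 h2
      have ih' := ih (by omega)
      rcases Nat.lt_or_ge j (q + 1 - k) with h | h
      · have hj : j = q + 1 - k - 1 := by omega
        have h3 := T2_eq hT β he (q + 1 - k) (by omega)
        have h4 : ∑ j ∈ Finset.range (q + 2), (if q + 1 - k ≤ j then β j else 0) = 0 := by
          refine Finset.sum_eq_zero fun j hj => ?_
          rw [Finset.mem_range] at hj
          split_ifs with hh
          · exact ih' j hh (by omega)
          · rfl
        rw [h4, mul_zero] at h3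
        have h5 : inc β (q + 1 - k) = 0 := by
          rcases mul_eq_zero.mp h3 with h | h
          · exact absurd h (wt_pos _ _).ne'
          · exact h
        rw [inc, if_neg (by omega), ih' (q + 1 - k) le_rfl (by omega)] at h5
        rw [hj]; linarith
      · exact ih' j h h2
  intro j hj
  exact key (q + 1) le_rfl j (by omega) hj

lemma T2_pos {q : ℕ} {lam : ℝ} (hT : TestIneq q lam) (hl : 0 < lam) (β : ℕ → ℝ)
    (he : ∑ j ∈ Finset.range (q + 2), wt q j * inc β j ^ 2
      ≤ 2 * lam * ∑ j ∈ Finset.range (q + 2), β j ^ 2) (hnn : ∀ j, j ≤ q + 1 → 0 ≤ β j)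
    (hne : ∃ j, j ≤ q + 1 ∧ β j ≠ 0) :
    ∀ i, i ≤ q + 1 → 0 < inc β i := by
  have htop : 0 < β (q + 1) := by
    rcases (hnn (q + 1) le_rfl).lt_or_eq with h | h
    · exact h
    · obtain ⟨j, hj, hj'⟩ := hne
      exact absurd (T2_zero hT β he h.symm j hj) hj'
  intro i hi
  have h := T2_eq hT β he i (by omega)
  have hs : 0 < ∑ j ∈ Finset.range (q + 2), (if i ≤ j then β j else 0) := by
    refine Finset.sum_pos' (fun j hj => ?_) ⟨q + 1, Finset.mem_range.mpr (by omega), ?_⟩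
    · rw [Finset.mem_range] at hj
      split_ifs
      · exact hnn j (by omega)
      · exact le_rfl
    · rw [if_pos hi]; exact htop
  have h2 : 0 < wt q i * inc β i := by rw [h]; positivity
  exact (pos_iff_pos_of_mul_pos h2).mp (wt_pos q i)

lemma test_eq {q : ℕ} {lam : ℝ} (hT : TestIneq q lam) (hl : 0 < lam) (L R : ℕ → ℝ) (u t : ℝ)
    (he : trhs q L R u t ≤ lam * tmass q L R u t)
    (hnn : ∀ j, j ≤ q → 0 ≤ L j) (hu : 0 ≤ u) (hu0 : u ≠ 0) :
    (∀ j, j ≤ q → R j = L j) ∧ t = u ∧ 0 < L 0 ∧ (∀ j, j < q → L j < L (j + 1)) ∧ L q < u := by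
  have hl1 := lam_le_one hT
  -- u = t
  have hut : t = u := by
    have h1 := trhs_par q L R L R u t t u
    have h2 := tmass_par q L R L R u t t u
    have h3 := hT (fun j => L j + L j) (fun j => R j + R j) (u + t) (t + u)
    have h4 : trhs q L R t u = trhs q L R u t := by simp only [trhs]; ring
    have h5 : tmass q L R t u = tmass q L R u t := by simp only [tmass]; ring
    rw [h4] at h1
    rw [h5] at h2
    have h6 : trhs q (fun j => L j - L j) (fun j => R j - R j) (u - t) (t - u)
        ≤ lam * tmass q (fun j => L j - L j) (fun j => R j - R j) (u - t) (t - u) := by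
      nlinarith
    simp only [trhs, tmass] at h6
    simp at h6
    have h7 : (u - t) ^ 2 ≤ 0 := by nlinarith [sq_nonneg (u - t)]
    have h8 : u - t = 0 := by nlinarith [sq_nonneg (u - t)]
    linarith
  -- D = 0
  let D : ℕ → ℝ := fun j => L j - R j
  have hD : ∑ j ∈ Finset.range q, (D (j + 1) - D j) ^ 2 + 2 * D q ^ 2
      ≤ lam * ∑ j ∈ Finset.range (q + 1), D j ^ 2 := by
    have h1 := trhs_par q L R R L u t u t
    have h2 := tmass_par q L R R L u t u t
    have h3 := hT (fun j => L j + R j) (fun j => R j + L j) (u + u) (t + t)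
    have h4 : trhs q R L u t = trhs q L R u t := by
      simp only [trhs, Finset.sum_add_distrib]; ring
    have h5 : tmass q R L u t = tmass q L R u t := by
      simp only [tmass, Finset.sum_add_distrib]; ring
    rw [h4] at h1
    rw [h5] at h2
    have h6 : trhs q (fun j => L j - R j) (fun j => R j - L j) (u - u) (t - t)
        ≤ lam * tmass q (fun j => L j - R j) (fun j => R j - L j) (u - u) (t - t) := by
      nlinarith
    have e1 : trhs q (fun j => L j - R j) (fun j => R j - L j) (u - u) (t - t)
        = 2 * (∑ j ∈ Finset.range q, (D (j + 1) - D j) ^ 2 + 2 * D q ^ 2) := by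
      have : ∑ j ∈ Finset.range q, ((L (j + 1) - R (j + 1) - (L j - R j)) ^ 2
          + (R (j + 1) - L (j + 1) - (R j - L j)) ^ 2) = 2 * ∑ j ∈ Finset.range q, (D (j + 1) - D j) ^ 2 := by
        rw [Finset.mul_sum]
        refine Finset.sum_congr rfl fun j _ => ?_
        simp only [D]; ring
      simp only [trhs, this]
      simp only [D]; ring
    have e2 : tmass q (fun j => L j - R j) (fun j => R j - L j) (u - u) (t - t)
        = 2 * ∑ j ∈ Finset.range (q + 1), D j ^ 2 := by
      simp only [tmass, Finset.sum_add_distrib, D]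
      have : ∑ j ∈ Finset.range (q + 1), (R j - L j) ^ 2 = ∑ j ∈ Finset.range (q + 1), (L j - R j) ^ 2 :=
        Finset.sum_congr rfl fun j _ => by ring
      rw [this]; ring
    rw [e1, e2] at h6
    linarith
  have hD0 : ∀ j, j ≤ q → D j = 0 := by
    let β : ℕ → ℝ := fun j => D (q - j)
    have hb1 : ∑ j ∈ Finset.range (q + 2), β j ^ 2 = ∑ j ∈ Finset.range (q + 1), D j ^ 2 + D 0 ^ 2 := by
      rw [Finset.sum_range_succ, ← Finset.sum_range_reflect (fun j => D j ^ 2)]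
      simp [β]
    have hb2 : ∑ j ∈ Finset.range (q + 2), wt q j * inc β j ^ 2
        = 2 * (∑ j ∈ Finset.range q, (D (j + 1) - D j) ^ 2 + 2 * D q ^ 2) := by
      rw [← paired_rhs]
      simp only [trhs]
      have : ∑ j ∈ Finset.range q, ((β (j + 1) - β j) ^ 2 + (β (j + 1) - β j) ^ 2)
          = 2 * ∑ j ∈ Finset.range q, (D (j + 1) - D j) ^ 2 := by
        rw [← Finset.sum_range_reflect, Finset.mul_sum]
        refine Finset.sum_congr rfl fun j hj => ?_
        rw [Finset.mem_range] at hj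
        simp only [β]
        rw [show q - (q - 1 - j + 1) = j by omega, show q - (q - 1 - j) = j + 1 by omega]
        ring
      rw [this]
      simp only [β, Nat.sub_zero, Nat.sub_self, show q - (q + 1) = 0 by omega]
      ring
    have h1 := T2 hT β
    rw [hb1, hb2] at h1
    have h2 : D 0 ^ 2 ≤ 0 := by
      by_contra h
      push Not at h
      nlinarith
    have h3 : D 0 = 0 := by nlinarith [sq_nonneg (D 0)]
    have h4 := T2_zero hT β (by rw [hb1, hb2, h3]; linarith) (by simp [β, h3])
    intro j hj
    have := h4 (q - j) (by omega)
    simp only [β] at this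
    rwa [show q - (q - j) = j by omega] at this
  have hRL : ∀ j, j ≤ q → R j = L j := by
    intro j hj
    have := hD0 j hj
    simp only [D] at this
    linarith
  let β : ℕ → ℝ := fun j => if j ≤ q then L j else u
  have hβ : ∀ j, j ≤ q → β j = L j := fun j hj => by simp [β, hj]
  have hβt : β (q + 1) = u := by simp [β]
  have e1 : trhs q L R u t = trhs q β β (β (q + 1)) (β (q + 1)) := by
    simp only [trhs]
    rw [hβ 0 (by omega), hβ q le_rfl, hβt, hut, hRL 0 (by omega), hRL q le_rfl]
    congr 5
    refine Finset.sum_congr rfl fun j hj => ?_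
    rw [Finset.mem_range] at hj
    rw [hβ j (by omega), hβ (j + 1) (by omega), hRL j (by omega), hRL (j + 1) (by omega)]
  have e2 : tmass q L R u t = tmass q β β (β (q + 1)) (β (q + 1)) := by
    simp only [tmass]
    rw [hβt, hut]
    congr 2
    refine Finset.sum_congr rfl fun j hj => ?_
    rw [Finset.mem_range] at hj
    rw [hβ j (by omega), hRL j (by omega)]
  rw [e1, e2, paired_rhs, paired_mass] at he
  have hinc := T2_pos hT hl β (by linarith) (by
    intro j hj
    by_cases h : j ≤ q
    · rw [hβ j h]; exact hnn j h
    · simp only [β, h, if_false]; exact hu) ⟨q + 1, le_rfl, by rw [hβt]; exact hu0⟩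
  refine ⟨hRL, hut, ?_, ?_, ?_⟩
  · have := hinc 0 (by omega)
    rw [inc, if_pos rfl, hβ 0 (by omega)] at this
    exact this
  · intro j hj
    have := hinc (j + 1) (by omega)
    rw [inc, if_neg (by omega), Nat.add_sub_cancel, hβ j (by omega), hβ (j + 1) (by omega)] at this
    linarith
  · have := hinc (q + 1) (by omega)
    rw [inc, if_neg (by omega), Nat.add_sub_cancel, hβ q le_rfl, hβt] at this
    linarith


/-- A 2-connected nonbipartite graph on `0, …, n-1`. -/
structure OGraph (n : ℕ) (A : ℕ → ℕ → Prop) : Prop where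
  four : 4 ≤ n
  even : Even n
  lt : ∀ p q, A p q → p < n ∧ q < n
  ne : ∀ p q, A p q → p ≠ q
  symm : ∀ p q, A p q → A q p
  cut : ∀ (v : ℕ) (S : ℕ → Prop), (∃ s, s < n ∧ S s ∧ s ≠ v) → (∃ t, t < n ∧ ¬ S t ∧ t ≠ v) →
    ∃ u w, A u w ∧ S u ∧ ¬ S w ∧ u ≠ v ∧ w ≠ v
  nonbip : ∀ sg : ℕ → Bool, ∃ u w, A u w ∧ sg u = sg w

/-- Gap vector of an edge `p < q`. -/
def gv (sg : ℕ → Bool) (p q i : ℕ) : ℕ :=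
  if p < i ∧ i ≤ q then 1 else if i ≤ p ∧ sg p = sg q then 2 else 0

/-- Gap matrix. -/
noncomputable def cc (n : ℕ) (A : ℕ → ℕ → Prop) (sg : ℕ → Bool) (i j : ℕ) : ℕ :=
  ∑ e ∈ (Finset.range n ×ˢ Finset.range n), if e.1 < e.2 ∧ A e.1 e.2 then gv sg e.1 e.2 i * gv sg e.1 e.2 j else 0

lemma gv_pass {sg : ℕ → Bool} {p q i : ℕ} (h1 : p < i) (h2 : i ≤ q) : gv sg p q i = 1 := by
  simp [gv, h1, h2]

lemma gv_odd {sg : ℕ → Bool} {p q i : ℕ} (h1 : i ≤ p) (h2 : sg p = sg q) : gv sg p q i = 2 := by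
  simp [gv, h1, h2]

section
variable {n : ℕ} {A : ℕ → ℕ → Prop} {sg : ℕ → Bool}

lemma cc_comm (i j : ℕ) : cc n A sg i j = cc n A sg j i := by
  unfold cc
  refine Finset.sum_congr rfl fun e _ => ?_
  rw [mul_comm]

lemma cc_ge (hG : OGraph n A) (T : Finset (ℕ × ℕ)) (hT : ∀ e ∈ T, e.1 < e.2 ∧ A e.1 e.2) (i j : ℕ) :
    ∑ e ∈ T, gv sg e.1 e.2 i * gv sg e.1 e.2 j ≤ cc n A sg i j := by
  unfold cc
  have h1 : ∑ e ∈ T, gv sg e.1 e.2 i * gv sg e.1 e.2 j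
      = ∑ e ∈ T, if e.1 < e.2 ∧ A e.1 e.2 then gv sg e.1 e.2 i * gv sg e.1 e.2 j else 0 :=
    Finset.sum_congr rfl fun e he => by rw [if_pos (hT e he)]
  rw [h1]
  refine Finset.sum_le_sum_of_subset fun e he => ?_
  have := hG.lt _ _ (hT e he).2
  simp [this]

lemma cc_ge1 (hG : OGraph n A) {p q : ℕ} (h : p < q) (h' : A p q) (i j : ℕ) :
    gv sg p q i * gv sg p q j ≤ cc n A sg i j := by
  have := cc_ge (sg := sg) hG {(p, q)} (by simp [h, h']) i j
  simpa using this

lemma cc_ge2 (hG : OGraph n A) {p q p' q' : ℕ} (h : p < q) (h' : A p q) (g : p' < q') (g' : A p' q')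
    (hne : p ≠ p' ∨ q ≠ q') (i j : ℕ) :
    gv sg p q i * gv sg p q j + gv sg p' q' i * gv sg p' q' j ≤ cc n A sg i j := by
  have := cc_ge (sg := sg) hG {(p, q), (p', q')} (by simp [h, h', g, g']) i j
  rw [Finset.sum_pair (by simp only [ne_eq, Prod.mk.injEq]; omega)] at this
  exact this

lemma cc_ge3 (hG : OGraph n A) {p q p' q' p'' q'' : ℕ} (h : p < q) (h' : A p q) (g : p' < q') (g' : A p' q')
    (k : p'' < q'') (k' : A p'' q'')
    (hne : p ≠ p' ∨ q ≠ q') (hne' : p ≠ p'' ∨ q ≠ q'') (hne'' : p' ≠ p'' ∨ q' ≠ q'') (i j : ℕ) :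
    gv sg p q i * gv sg p q j + (gv sg p' q' i * gv sg p' q' j + gv sg p'' q'' i * gv sg p'' q'' j)
      ≤ cc n A sg i j := by
  have := cc_ge (sg := sg) hG {(p, q), (p', q'), (p'', q'')} (by simp [h, h', g, g', k, k']) i j
  rw [Finset.sum_insert (by simp only [Finset.mem_insert, Finset.mem_singleton, Prod.mk.injEq]; omega), Finset.sum_pair (by simp only [ne_eq, Prod.mk.injEq]; omega)] at this
  exact this

lemma cc_ge4 (hG : OGraph n A) {p q p' q' p'' q'' a b : ℕ} (h : p < q) (h' : A p q) (g : p' < q') (g' : A p' q')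
    (k : p'' < q'') (k' : A p'' q'') (l : a < b) (l' : A a b)
    (hne : p ≠ p' ∨ q ≠ q') (hne' : p ≠ p'' ∨ q ≠ q'') (hne'' : p' ≠ p'' ∨ q' ≠ q'')
    (m1 : p ≠ a ∨ q ≠ b) (m2 : p' ≠ a ∨ q' ≠ b) (m3 : p'' ≠ a ∨ q'' ≠ b) (i j : ℕ) :
    gv sg p q i * gv sg p q j + (gv sg p' q' i * gv sg p' q' j + (gv sg p'' q'' i * gv sg p'' q'' j
      + gv sg a b i * gv sg a b j)) ≤ cc n A sg i j := by
  have := cc_ge (sg := sg) hG {(p, q), (p', q'), (p'', q''), (a, b)} (by simp [h, h', g, g', k, k', l, l']) i j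
  rw [Finset.sum_insert (by simp only [Finset.mem_insert, Finset.mem_singleton, Prod.mk.injEq]; omega), Finset.sum_insert (by simp only [Finset.mem_insert, Finset.mem_singleton, Prod.mk.injEq]; omega),
    Finset.sum_pair (by simp only [ne_eq, Prod.mk.injEq]; omega)] at this
  exact this

lemma cut_single (hG : OGraph n A) {v r : ℕ} (hr : r < n) (hv : r ≠ v) : ∃ z, A r z ∧ z ≠ v := by
  have h4 := hG.four
  have ht : ∃ t, t < n ∧ t ≠ r ∧ t ≠ v := by
    by_cases h0 : 0 ≠ r ∧ 0 ≠ v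
    · exact ⟨0, by omega, h0.1, h0.2⟩
    by_cases h1 : 1 ≠ r ∧ 1 ≠ v
    · exact ⟨1, by omega, h1.1, h1.2⟩
    exact ⟨2, by omega, by omega, by omega⟩
  obtain ⟨t, h1, h2, h3⟩ := ht
  obtain ⟨u, w, a, b, _, _, d⟩ := hG.cut v (fun x => x = r) ⟨r, hr, rfl, hv⟩ ⟨t, h1, h2, h3⟩
  exact ⟨w, b ▸ a, d⟩

lemma cut_le (hG : OGraph n A) (v k s t : ℕ) (hs : s ≤ k) (hsv : s ≠ v) (ht : k < t) (htn : t < n)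
    (htv : t ≠ v) : ∃ u w, A u w ∧ u ≤ k ∧ k < w ∧ u ≠ v ∧ w ≠ v := by
  obtain ⟨u, w, a, b, c, d, e⟩ := hG.cut v (fun x => x ≤ k) ⟨s, by omega, hs, hsv⟩ ⟨t, htn, by omega, htv⟩
  exact ⟨u, w, a, b, by omega, d, e⟩

/-- Basic lower bounds for the gap matrix. -/
lemma cc_base (hG : OGraph n A) (sg : ℕ → Bool) :
    4 ≤ cc n A sg 0 0 ∧ 2 ≤ cc n A sg 0 1 ∧ (∀ i, 1 ≤ i → i < n → 2 ≤ cc n A sg i i) ∧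
      (∀ i, 1 ≤ i → i + 1 < n → 1 ≤ cc n A sg i (i + 1)) := by
  have h4 := hG.four
  have hodd : ∃ p q, A p q ∧ p < q ∧ sg p = sg q := by
    obtain ⟨u, w, h, h'⟩ := hG.nonbip sg
    rcases lt_or_gt_of_ne (hG.ne _ _ h) with g | g
    · exact ⟨u, w, h, g, h'⟩
    · exact ⟨w, u, hG.symm _ _ h, g, h'.symm⟩
  obtain ⟨p, q, h, h', hs⟩ := hodd
  refine ⟨?_, ?_, ?_, ?_⟩
  · have := cc_ge1 (sg := sg) hG h' h 0 0
    rw [gv_odd (Nat.zero_le p) hs] at this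
    omega
  · have := cc_ge1 (sg := sg) hG h' h 0 1
    rw [gv_odd (Nat.zero_le p) hs] at this
    rcases Nat.eq_zero_or_pos p with hp | hp
    · rw [gv_pass (by omega) (by omega)] at this; omega
    · rw [gv_odd hp hs] at this; omega
  · intro i hi hin
    have key : ∃ p q p' q', A p q ∧ A p' q' ∧ p < i ∧ i ≤ q ∧ p' < i ∧ i ≤ q' ∧ (p ≠ p' ∨ q ≠ q') := by
      rcases Nat.eq_or_lt_of_le hi with h1 | h1
      · obtain ⟨u, w, a, b, c, d, e⟩ := cut_le hG 1 0 0 2 le_rfl (by omega) (by omega) (by omega) (by omega)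
        obtain ⟨z, hz, hz'⟩ := cut_single hG (v := w) (r := 0) (by omega) (by omega)
        have := hG.ne _ _ hz
        have hu : u = 0 := by omega
        subst hu
        exact ⟨0, w, 0, z, a, hz, by omega, by omega, by omega, by omega, Or.inr (Ne.symm hz')⟩
      · have : ∃ u w, A u w ∧ u ≤ i - 1 ∧ i - 1 < w := by
          by_cases hi1 : i + 1 < n
          · obtain ⟨u, w, a, b, c, d, e⟩ := cut_le hG i (i - 1) 0 (i + 1) (by omega) (by omega) (by omega) (by omega) (by omega)
            exact ⟨u, w, a, b, c⟩
          · obtain ⟨u, w, a, b, c, d, e⟩ := cut_le hG 0 (i - 1) 1 i (by omega) (by omega) (by omega) (by omega) (by omega)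
            exact ⟨u, w, a, b, c⟩
        obtain ⟨u, w, a, b, c⟩ := this
        have hx : ∃ x, x ≤ i - 1 ∧ x ≠ u := by
          by_cases hu : u = 0
          · exact ⟨1, by omega, by omega⟩
          · exact ⟨0, by omega, by omega⟩
        obtain ⟨x, hx, hxu⟩ := hx
        obtain ⟨u', w', a', b', c', d', e'⟩ := cut_le hG u (i - 1) x i hx hxu (by omega) (by omega) (by omega)
        exact ⟨u, w, u', w', a, a', by omega, by omega, by omega, by omega, Or.inl (Ne.symm d')⟩
    obtain ⟨p, q, p', q', a, b, c, d, e, f, g⟩ := key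
    have := cc_ge2 (sg := sg) hG (by omega) a (by omega) b g i i
    rw [gv_pass c d, gv_pass e f] at this
    omega
  · intro i hi hin
    obtain ⟨u, w, a, b, c, d, e⟩ := cut_le hG i (i - 1) 0 (i + 1) (by omega) (by omega) (by omega) (by omega) (by omega)
    have := cc_ge1 (sg := sg) hG (by omega) a i (i + 1)
    rw [gv_pass (by omega) (by omega), gv_pass (by omega) (by omega)] at this
    omega

/-- Outcome of the combinatorial analysis. -/
def Outc (n : ℕ) (A : ℕ → ℕ → Prop) (sg : ℕ → Bool) : Prop :=
  (4 ≤ cc n A sg 0 1 ∧ 4 ≤ cc n A sg 1 1 ∧ 2 ≤ cc n A sg 0 2 ∧ 2 ≤ cc n A sg 1 2) ∨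
  (∃ r, r + 5 ≤ n ∧ 2 ≤ cc n A sg (r + 1) (r + 2) ∧ (if r = 0 then 2 else 1) ≤ cc n A sg r (r + 2) ∧
    1 ≤ cc n A sg (r + 1) (r + 3)) ∨
  (∃ r, r + 4 = n ∧ 2 ≤ cc n A sg (r + 1) (r + 2) ∧ (if r = 0 then 2 else 1) ≤ cc n A sg r (r + 2) ∧
    1 ≤ cc n A sg (r + 1) (r + 3) ∧ 3 ≤ cc n A sg (r + 1) (r + 1) ∧ 3 ≤ cc n A sg (r + 2) (r + 2)) ∨
  (∃ r, r + 4 = n ∧ 2 ≤ cc n A sg (r + 1) (r + 2) ∧ 1 ≤ cc n A sg (r + 1) (r + 3) ∧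
    2 ≤ cc n A sg (r + 2) (r + 3) ∧ 3 ≤ cc n A sg (r + 1) (r + 1) ∧ 4 ≤ cc n A sg (r + 2) (r + 2))

/-- State of the analysis. -/
structure St (n : ℕ) (A : ℕ → ℕ → Prop) (sg : ℕ → Bool) (t s : ℕ) (U W : ℕ → Prop) (α β : Bool) : Prop where
  htn : t + 1 < n
  hst : s ≤ t
  hU : ∀ q, U q → t + 1 ≤ q ∧ A s q
  hW : ∀ q, W q → t + 1 ≤ q ∧ A t q
  hall : ∀ p q, A p q → p ≤ t → t + 1 ≤ q → (p = s ∧ U q) ∨ (p = t ∧ W q)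
  hUn : ∃ q, U q
  hWn : ∃ q, W q
  hd : ∀ q, U q → W q → s ≠ t
  hg : t = 0 → ∀ q, U q → sg 0 = sg q
  hs : 1 ≤ t → s < t ∧ ∃ p, p < t ∧ A p t
  hα : ∀ q, U q → sg q = α
  hβ : ∀ q, W q → sg q = β
  hαβ : α = β ↔ Odd t

lemma bool_ne_ne {a b c : Bool} (h1 : a ≠ b) (h2 : a ≠ c) : b = c := by
  cases a <;> cases b <;> cases c <;> simp_all

lemma gv_low {t s : ℕ} {U W : ℕ → Prop} {α β : Bool} (h : St n A sg t s U W α β) {q : ℕ} (hq : U q) :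
    (if t = 0 then 2 else 1) ≤ gv sg s q t := by
  have h1 := h.hst
  have h2 := (h.hU q hq).1
  split_ifs with h0
  · have hs0 : s = 0 := by omega
    subst hs0
    rw [gv_odd (by omega) (h.hg h0 q hq)]
  · rw [gv_pass (h.hs (by omega)).1 (by omega)]

/-- Case r. -/
lemma out_r (hG : OGraph n A) {t s : ℕ} {U W : ℕ → Prop} {α β : Bool} (h : St n A sg t s U W α β)
    {u w : ℕ} (hu : U u) (hut : t + 2 ≤ u) (hw : W w) (hwt : t + 2 ≤ w) (hbig : t + 3 ≤ u ∨ t + 3 ≤ w) :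
    2 ≤ cc n A sg (t + 1) (t + 2) ∧ (if t = 0 then 2 else 1) ≤ cc n A sg t (t + 2) ∧
    1 ≤ cc n A sg (t + 1) (t + 3) := by
  have hst := h.hst
  have hsu := (h.hU u hu).2
  have htw := (h.hW w hw).2
  have hne : s ≠ t ∨ u ≠ w := by
    by_contra hc
    push Not at hc
    exact h.hd u hu (hc.2 ▸ hw) hc.1
  refine ⟨?_, ?_, ?_⟩
  · have := cc_ge2 (sg := sg) hG (by omega) hsu (by omega) htw hne (t + 1) (t + 2)
    rw [gv_pass (by omega) (by omega), gv_pass (by omega) (by omega), gv_pass (by omega) (by omega),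
      gv_pass (by omega) (by omega)] at this
    omega
  · have := cc_ge1 (sg := sg) hG (by omega) hsu t (t + 2)
    rw [gv_pass (i := t + 2) (by omega) (by omega), mul_one] at this
    exact (gv_low h hu).trans this
  · rcases hbig with hb | hb
    · have := cc_ge1 (sg := sg) hG (by omega) hsu (t + 1) (t + 3)
      rw [gv_pass (by omega) (by omega), gv_pass (by omega) (by omega)] at this
      omega
    · have := cc_ge1 (sg := sg) hG (by omega) htw (t + 1) (t + 3)
      rw [gv_pass (by omega) (by omega), gv_pass (by omega) (by omega)] at this
      omega

lemma step (hG : OGraph n A) (H0 : ∀ p q, A p q → 1 ≤ p → 1 ≤ q → sg p ≠ sg q)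
    {t s : ℕ} {U W : ℕ → Prop} {α β : Bool} (h : St n A sg t s U W α β) :
    Outc n A sg ∨ ∃ t' s' U' W' α' β', t < t' ∧ St n A sg t' s' U' W' α' β' := by
  have h4 := hG.four
  have hst := h.hst
  have htn := h.htn
  have hlt := hG.lt
  have hsym := hG.symm
  have hne := hG.ne
  have hev := hG.even
  have upflip : ∀ (p : ℕ) (c : Bool), 1 ≤ p → sg p = c → ∀ q, (p < q ∧ A p q) → sg q = !c := by
    intro p c hp hc q hq
    have := H0 p q hq.2 hp (by omega)
    rw [hc] at this
    cases c <;> cases hh : sg q <;> simp_all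
  by_cases hU' : ∃ u, U u ∧ u ≠ t + 1
  swap
  · -- U = {r}
    push Not at hU'
    have hUr : U (t + 1) := by
      obtain ⟨q, hq⟩ := h.hUn
      exact hU' q hq ▸ hq
    by_cases hr : t + 2 = n
    · exfalso
      have hWr : W (t + 1) := by
        obtain ⟨q, hq⟩ := h.hWn
        have h1 := h.hW q hq
        have h2 := hlt _ _ h1.2
        have : q = t + 1 := by omega
        exact this ▸ hq
      have h3 : α = β := (h.hα _ hUr).symm.trans (h.hβ _ hWr)
      have h4 := h.hαβ.mp h3
      rw [← hr] at hev
      rw [Nat.even_add] at hev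
      simp at hev
      exact (Nat.not_even_iff_odd.mpr h4) hev
    · right
      refine ⟨t + 1, t, fun q => W q ∧ q ≠ t + 1, fun q => t + 1 < q ∧ A (t + 1) q, β, !α, by omega, ?_⟩
      refine ⟨by omega, by omega, ?_, ?_, ?_, ?_, ?_, ?_, by omega, ?_, ?_, ?_, ?_⟩
      · intro q hq
        have := h.hW q hq.1
        exact ⟨by have := hq.2; omega, this.2⟩
      · intro q hq
        exact ⟨by omega, hq.2⟩
      · intro p q hpq hp hq
        rcases Nat.lt_or_ge t p with hp' | hp'
        · have : p = t + 1 := by omega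
          subst this
          exact Or.inr ⟨rfl, by omega, hpq⟩
        · rcases h.hall p q hpq hp' (by omega) with ⟨_, h2⟩ | ⟨h1, h2⟩
          · have := hU' q h2; omega
          · exact Or.inl ⟨h1, h2, by omega⟩
      · obtain ⟨u, w, a, b, c, d, e⟩ := cut_le hG (t + 1) t t (t + 2) le_rfl (by omega) (by omega) (by omega) (by omega)
        rcases h.hall u w a b c with ⟨_, h2⟩ | ⟨h1, h2⟩
        · exact absurd (hU' w h2) e
        · exact ⟨w, h2, e⟩
      · by_cases hWr : W (t + 1)
        · obtain ⟨u, w, a, b, c, d, e⟩ := cut_le hG t (t + 1) (t + 1) (t + 2) le_rfl (by omega) (by omega) (by omega) (by omega)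
          rcases Nat.lt_or_ge t u with hp' | hp'
          · have : u = t + 1 := by omega
            subst this
            exact ⟨w, c, a⟩
          · rcases h.hall u w a hp' (by omega) with ⟨_, h2⟩ | ⟨h1, h2⟩
            · have := hU' w h2; omega
            · exact absurd h1 d
        · obtain ⟨z, hz, hz'⟩ := cut_single hG (v := s) (r := t + 1) htn (by omega)
          refine ⟨z, ?_, hz⟩
          by_contra hc
          have hz2 := hne _ _ hz
          rcases h.hall z (t + 1) (hsym _ _ hz) (by omega) le_rfl with ⟨h1, _⟩ | ⟨_, h2⟩
          · exact hz' h1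
          · exact hWr h2
      · intro q _ _; omega
      · intro _
        exact ⟨by omega, s, by omega, (h.hU _ hUr).2⟩
      · intro q hq; exact h.hβ q hq.1
      · exact upflip (t + 1) α (by omega) (h.hα _ hUr)
      · have := h.hαβ
        rw [Nat.odd_add_one, ← this]
        cases α <;> cases β <;> simp
  obtain ⟨u, hu, hur⟩ := hU'
  have hu1 := h.hU u hu
  have hun := hlt _ _ hu1.2
  by_cases hW' : ∃ w, W w ∧ w ≠ t + 1
  swap
  · push Not at hW'
    have hWr : W (t + 1) := by
      obtain ⟨q, hq⟩ := h.hWn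
      exact hW' q hq ▸ hq
    right
    refine ⟨t + 1, s, fun q => U q ∧ q ≠ t + 1, fun q => t + 1 < q ∧ A (t + 1) q, α, !β, by omega, ?_⟩
    refine ⟨by omega, by omega, ?_, ?_, ?_, ⟨u, hu, hur⟩, ?_, ?_, by omega, ?_, ?_, ?_, ?_⟩
    · intro q hq
      have := h.hU q hq.1
      exact ⟨by have := hq.2; omega, this.2⟩
    · intro q hq
      exact ⟨by omega, hq.2⟩
    · intro p q hpq hp hq
      rcases Nat.lt_or_ge t p with hp' | hp'
      · have : p = t + 1 := by omega
        subst this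
        exact Or.inr ⟨rfl, by omega, hpq⟩
      · rcases h.hall p q hpq hp' (by omega) with ⟨h1, h2⟩ | ⟨h1, h2⟩
        · exact Or.inl ⟨h1, h2, by omega⟩
        · have := hW' q h2; omega
    · by_cases hUr : U (t + 1)
      · obtain ⟨u, w, a, b, c, d, e⟩ := cut_le hG s (t + 1) (t + 1) (t + 2) le_rfl (by omega) (by omega) (by omega) (by omega)
        rcases Nat.lt_or_ge t u with hp' | hp'
        · have : u = t + 1 := by omega
          subst this
          exact ⟨w, c, a⟩
        · rcases h.hall u w a hp' (by omega) with ⟨h1, h2⟩ | ⟨h1, h2⟩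
          · exact absurd h1 d
          · have := hW' w h2; omega
      · obtain ⟨z, hz, hz'⟩ := cut_single hG (v := t) (r := t + 1) htn (by omega)
        refine ⟨z, ?_, hz⟩
        by_contra hc
        have hz2 := hne _ _ hz
        rcases h.hall z (t + 1) (hsym _ _ hz) (by omega) le_rfl with ⟨_, h2⟩ | ⟨h1, _⟩
        · exact hUr h2
        · exact hz' h1
    · intro q _ _; omega
    · intro _
      exact ⟨by omega, t, by omega, (h.hW _ hWr).2⟩
    · intro q hq; exact h.hα q hq.1
    · exact upflip (t + 1) β (by omega) (h.hβ _ hWr)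
    · have := h.hαβ
      rw [Nat.odd_add_one, ← this]
      cases α <;> cases β <;> simp
  obtain ⟨w, hw, hwr⟩ := hW'
  have hw1 := h.hW w hw
  have hwn := hlt _ _ hw1.2
  have hsu := hu1.2
  have htw := hw1.2
  by_cases hbig : (∃ u, U u ∧ t + 3 ≤ u) ∨ (∃ w, W w ∧ t + 3 ≤ w)
  · have hbig' : ∃ u w, U u ∧ W w ∧ t + 2 ≤ u ∧ t + 2 ≤ w ∧ (t + 3 ≤ u ∨ t + 3 ≤ w) := by
      rcases hbig with ⟨u', hu', hb⟩ | ⟨w', hw', hb⟩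
      · exact ⟨u', w, hu', hw, by omega, by omega, Or.inl hb⟩
      · exact ⟨u, w', hu, hw', by omega, by omega, Or.inr hb⟩
    clear hbig hu hw hu1 hw1 hsu htw hun hwn hwr hur u w
    obtain ⟨u, w, hu, hw, hut, hwt, hb⟩ := hbig'
    obtain ⟨o1, o2, o3⟩ := out_r hG h hu hut hw hwt hb
    have hsu := (h.hU u hu).2
    have htw := (h.hW w hw).2
    have hun := (hlt _ _ hsu).2
    have hwn := (hlt _ _ htw).2
    by_cases hn5 : t + 5 ≤ n
    · left
      exact Or.inr (Or.inl ⟨t, hn5, o1, o2, o3⟩)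
    · have hn4 : t + 4 = n := by omega
      have hab : α ≠ β := by
        intro hc
        have := h.hαβ.mp hc
        rw [← hn4, Nat.even_add] at hev
        have h5 : Even t := hev.mpr (by decide)
        exact (Nat.not_even_iff_odd.mpr this) h5
      have hα := h.hα u hu
      have hβ := h.hβ w hw
      have huw : u ≠ w := by
        rintro rfl
        exact hab (hα.symm.trans hβ)
      left
      refine Or.inr (Or.inr (Or.inl ⟨t, hn4, o1, o2, o3, ?_⟩))
      by_cases hUr : U (t + 1)
      · have hsr := (h.hU _ hUr).2
        have hrα := h.hα _ hUr
        have hrw : A (t + 1) w := by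
          obtain ⟨z, hz, hz'⟩ := cut_single hG (v := s) (r := t + 1) htn (by omega)
          have hz2 := hne _ _ hz
          have hz3 := hlt _ _ hz
          rcases Nat.lt_or_ge t z with hzt | hzt
          · have hs1 := H0 _ _ hz (by omega) (by omega)
            have : z ≠ u := by
              rintro rfl
              exact hs1 (hrα.trans hα.symm)
            have : z = w := by omega
            exact this ▸ hz
          · rcases h.hall z (t + 1) (hsym _ _ hz) (by omega) le_rfl with ⟨h1, _⟩ | ⟨_, h2⟩
            · exact absurd h1 hz'
            · exact absurd (hrα.symm.trans (h.hβ _ h2)) hab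
        constructor
        · have := cc_ge3 (sg := sg) hG (by omega) hsr (by omega) hsu (by omega) htw (by omega) (by omega) (by omega) (t + 1) (t + 1)
          rw [gv_pass (by omega) (by omega), gv_pass (by omega) (by omega), gv_pass (by omega) (by omega)] at this
          omega
        · have := cc_ge3 (sg := sg) hG (by omega) hsu (by omega) htw (by omega) hrw (by omega) (by omega) (by omega) (t + 2) (t + 2)
          rw [gv_pass (by omega) (by omega), gv_pass (by omega) (by omega), gv_pass (by omega) (by omega)] at this
          omega
      by_cases hWr : W (t + 1)
      · have htr := (h.hW _ hWr).2
        have hrβ := h.hβ _ hWr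
        have hru : A (t + 1) u := by
          obtain ⟨z, hz, hz'⟩ := cut_single hG (v := t) (r := t + 1) htn (by omega)
          have hz2 := hne _ _ hz
          have hz3 := hlt _ _ hz
          rcases Nat.lt_or_ge t z with hzt | hzt
          · have hs1 := H0 _ _ hz (by omega) (by omega)
            have : z ≠ w := by
              rintro rfl
              exact hs1 (hrβ.trans hβ.symm)
            have : z = u := by omega
            exact this ▸ hz
          · rcases h.hall z (t + 1) (hsym _ _ hz) (by omega) le_rfl with ⟨_, h2⟩ | ⟨h1, _⟩
            · exact absurd h2 hUr
            · exact absurd h1 hz'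
        constructor
        · have := cc_ge3 (sg := sg) hG (by omega) htr (by omega) htw (by omega) hsu (by omega) (by omega) (by omega) (t + 1) (t + 1)
          rw [gv_pass (by omega) (by omega), gv_pass (by omega) (by omega), gv_pass (by omega) (by omega)] at this
          omega
        · have := cc_ge3 (sg := sg) hG (by omega) htw (by omega) hsu (by omega) hru (by omega) (by omega) (by omega) (t + 2) (t + 2)
          rw [gv_pass (by omega) (by omega), gv_pass (by omega) (by omega), gv_pass (by omega) (by omega)] at this
          omega
      exfalso
      have hup : ∀ z, A (t + 1) z → t + 1 < z := by
        intro z hz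
        have hz2 := hne _ _ hz
        by_contra hc
        rcases h.hall z (t + 1) (hsym _ _ hz) (by omega) le_rfl with ⟨_, h2⟩ | ⟨_, h2⟩
        · exact hUr h2
        · exact hWr h2
      obtain ⟨z, hz, hz'⟩ := cut_single hG (v := w) (r := t + 1) htn (by omega)
      obtain ⟨y, hy, hy'⟩ := cut_single hG (v := u) (r := t + 1) htn (by omega)
      have hzn := hlt _ _ hz
      have hyn := hlt _ _ hy
      have hzu := hup z hz
      have hyu := hup y hy
      have e1 : z = u := by omega
      have e2 : y = w := by omega
      subst e1 e2
      have g1 := H0 _ _ hz (by omega) (by omega)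
      have g2 := H0 _ _ hy (by omega) (by omega)
      exact hab (hα.symm.trans ((bool_ne_ne g1 g2).trans hβ))
  · push Not at hbig
    obtain ⟨hb1, hb2⟩ := hbig
    have eu : u = t + 2 := by have := hb1 u hu; omega
    have ew : w = t + 2 := by have := hb2 w hw; omega
    subst eu
    subst ew
    have hab : α = β := (h.hα _ hu).symm.trans (h.hβ _ hw)
    have hodd := h.hαβ.mp hab
    have ht1 : 1 ≤ t := by
      rcases hodd with ⟨k, hk⟩; omega
    obtain ⟨hst', p, hp, hpt⟩ := h.hs ht1
    have hUW : ∀ q, U q ∨ W q → q = t + 1 ∨ q = t + 2 := by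
      rintro q (hq | hq)
      · have := hb1 q hq; have := (h.hU q hq).1; omega
      · have := hb2 q hq; have := (h.hW q hq).1; omega
    have hlow : ∀ p q, A p q → p ≤ t → t + 3 ≤ q → False := by
      intro p q hpq h1 h2
      rcases h.hall p q hpq h1 (by omega) with ⟨_, h3⟩ | ⟨_, h3⟩
      · have := hb1 q h3; omega
      · have := hb2 q h3; omega
    have hor : U (t + 1) ∨ W (t + 1) := by
      obtain ⟨u, w, a, b, c, d, e⟩ := cut_le hG (t + 2) t t (t + 1) le_rfl (by omega) (by omega) (by omega) (by omega)
      rcases h.hall u w a b c with ⟨_, h3⟩ | ⟨_, h3⟩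
      · have := hUW w (Or.inl h3)
        have : w = t + 1 := by omega
        exact Or.inl (this ▸ h3)
      · have := hUW w (Or.inr h3)
        have : w = t + 1 := by omega
        exact Or.inr (this ▸ h3)
    have hrα : sg (t + 1) = α := by
      rcases hor with h1 | h1
      · exact h.hα _ h1
      · rw [hab]; exact h.hβ _ h1
    have hr1α : sg (t + 2) = α := h.hα _ hu
    have hnadj : ¬ A (t + 1) (t + 2) := fun hc => H0 _ _ hc (by omega) (by omega) (hrα.trans hr1α.symm)
    by_cases hn3 : t + 3 < n
    · right
      refine ⟨t + 2, t + 1, fun q => t + 2 < q ∧ A (t + 1) q, fun q => t + 2 < q ∧ A (t + 2) q, !α, !α, by omega, ?_⟩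
      refine ⟨by omega, by omega, ?_, ?_, ?_, ?_, ?_, ?_, by omega, ?_, ?_, ?_, ?_⟩
      · intro q hq; exact ⟨by omega, hq.2⟩
      · intro q hq; exact ⟨by omega, hq.2⟩
      · intro p q hpq hp hq
        rcases Nat.lt_or_ge t p with hp' | hp'
        · have : p = t + 1 ∨ p = t + 2 := by omega
          rcases this with rfl | rfl
          · exact Or.inl ⟨rfl, by omega, hpq⟩
          · exact Or.inr ⟨rfl, by omega, hpq⟩
        · exact (hlow p q hpq hp' (by omega)).elim
      · obtain ⟨u, w, a, b, c, d, e⟩ := cut_le hG (t + 2) (t + 2) (t + 1) (t + 3) (by omega) (by omega) (by omega) (by omega) (by omega)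
        rcases Nat.lt_or_ge t u with hp' | hp'
        · have : u = t + 1 := by omega
          exact ⟨w, c, this ▸ a⟩
        · exact (hlow u w a hp' (by omega)).elim
      · obtain ⟨u, w, a, b, c, d, e⟩ := cut_le hG (t + 1) (t + 2) (t + 2) (t + 3) (by omega) (by omega) (by omega) (by omega) (by omega)
        rcases Nat.lt_or_ge t u with hp' | hp'
        · have : u = t + 2 := by omega
          exact ⟨w, c, this ▸ a⟩
        · exact (hlow u w a hp' (by omega)).elim
      · intro q _ _; omega
      · intro _; exact ⟨by omega, s, by omega, hsu⟩
      · intro q hq; exact upflip (t + 1) α (by omega) hrα q ⟨by omega, hq.2⟩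
      · intro q hq; exact upflip (t + 2) α (by omega) hr1α q ⟨by omega, hq.2⟩
      · simp only [true_iff]
        obtain ⟨k, hk⟩ := hodd
        exact ⟨k + 1, by omega⟩
    · have hn : t + 3 = n := by omega
      have hrn : ∀ z, A (t + 1) z → z ≤ t := by
        intro z hz
        have := hlt _ _ hz
        have := hne _ _ hz
        by_contra hc
        have : z = t + 2 := by omega
        exact hnadj (this ▸ hz)
      have hUr : U (t + 1) := by
        obtain ⟨z, hz, hz'⟩ := cut_single hG (v := t) (r := t + 1) htn (by omega)
        rcases h.hall z (t + 1) (hsym _ _ hz) (hrn z hz) le_rfl with ⟨_, h2⟩ | ⟨h1, _⟩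
        · exact h2
        · exact absurd h1 hz'
      have hWr : W (t + 1) := by
        obtain ⟨z, hz, hz'⟩ := cut_single hG (v := s) (r := t + 1) htn (by omega)
        rcases h.hall z (t + 1) (hsym _ _ hz) (hrn z hz) le_rfl with ⟨h1, _⟩ | ⟨_, h2⟩
        · exact absurd h1 hz'
        · exact h2
      have hsr := (h.hU _ hUr).2
      have htr := (h.hW _ hWr).2
      left
      obtain ⟨r, rfl⟩ : ∃ r, t = r + 1 := ⟨t - 1, by omega⟩
      refine Or.inr (Or.inr (Or.inr ⟨r, by omega, ?_, ?_, ?_, ?_, ?_⟩))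
      · have := cc_ge2 (sg := sg) hG (by omega) hsr (by omega) hsu (by omega) (r + 1) (r + 2)
        rw [gv_pass (by omega) (by omega), gv_pass (by omega) (by omega), gv_pass (by omega) (by omega), gv_pass (by omega) (by omega)] at this
        omega
      · have := cc_ge1 (sg := sg) hG (by omega) hsu (r + 1) (r + 3)
        rw [gv_pass (by omega) (by omega), gv_pass (by omega) (by omega)] at this
        omega
      · have := cc_ge2 (sg := sg) hG (by omega) hsu (by omega) htw (by omega) (r + 2) (r + 3)
        rw [gv_pass (by omega) (by omega), gv_pass (by omega) (by omega), gv_pass (by omega) (by omega), gv_pass (by omega) (by omega)] at this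
        omega
      · have := cc_ge3 (sg := sg) hG (by omega) hsr (by omega) hsu (by omega) hpt (by omega) (by omega) (by omega) (r + 1) (r + 1)
        rw [gv_pass (by omega) (by omega), gv_pass (by omega) (by omega), gv_pass (by omega) (by omega)] at this
        omega
      · have := cc_ge4 (sg := sg) hG (by omega) hsr (by omega) hsu (by omega) htr (by omega) htw
          (by omega) (by omega) (by omega) (by omega) (by omega) (by omega) (r + 2) (r + 2)
        rw [gv_pass (by omega) (by omega), gv_pass (by omega) (by omega), gv_pass (by omega) (by omega), gv_pass (by omega) (by omega)] at this
        omega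

lemma St_out (hG : OGraph n A) (H0 : ∀ p q, A p q → 1 ≤ p → 1 ≤ q → sg p ≠ sg q) :
    ∀ (k t s : ℕ) (U W : ℕ → Prop) (α β : Bool), n ≤ t + k → St n A sg t s U W α β → Outc n A sg := by
  intro k
  induction k with
  | zero =>
    intro t s U W α β hk h
    have := h.htn; omega
  | succ k ih =>
    intro t s U W α β hk h
    rcases step hG H0 h with h1 | ⟨t', s', U', W', α', β', hlt, h1⟩
    · exact h1
    · exact ih t' s' U' W' α' β' (by omega) h1

lemma comb (hG : OGraph n A) (sg : ℕ → Bool) : Outc n A sg := by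
  have h4 := hG.four
  by_cases H0 : ∀ p q, A p q → 1 ≤ p → 1 ≤ q → sg p ≠ sg q
  · refine St_out hG H0 n 0 0 (fun q => A 0 q ∧ sg 0 = sg q) (fun q => A 0 q ∧ sg 0 ≠ sg q) (sg 0) (!(sg 0)) (by omega) ?_
    have pos : ∀ q, A 0 q → 1 ≤ q := fun q hq => by have := hG.ne _ _ hq; omega
    refine ⟨by omega, le_rfl, fun q hq => ⟨pos q hq.1, hq.1⟩, fun q hq => ⟨pos q hq.1, hq.1⟩, ?_, ?_, ?_, ?_, ?_, by omega, ?_, ?_, ?_⟩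
    · intro p q hpq hp hq
      have : p = 0 := by omega
      subst this
      by_cases hs : sg 0 = sg q
      · exact Or.inl ⟨rfl, hpq, hs⟩
      · exact Or.inr ⟨rfl, hpq, hs⟩
    · obtain ⟨u, w, h, h'⟩ := hG.nonbip sg
      by_cases hu : u = 0
      · subst hu; exact ⟨w, h, h'⟩
      by_cases hw : w = 0
      · subst hw; exact ⟨u, hG.symm _ _ h, h'.symm⟩
      exact absurd h' (H0 _ _ h (by omega) (by omega))
    · obtain ⟨u, w, h, h'⟩ := hG.nonbip (fun x => if x = 0 then !(sg 0) else sg x)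
      have huw := hG.ne _ _ h
      by_cases hu : u = 0
      · subst hu
        refine ⟨w, h, ?_⟩
        simp only [if_true, if_neg (Ne.symm huw)] at h'
        intro hc
        rw [← hc] at h'
        cases hh : sg 0 <;> simp_all
      by_cases hw : w = 0
      · subst hw
        refine ⟨u, hG.symm _ _ h, ?_⟩
        simp only [if_true, if_neg huw] at h'
        intro hc
        rw [← hc] at h'
        cases hh : sg 0 <;> simp_all
      simp only [if_neg hu, if_neg hw] at h'
      exact absurd h' (H0 _ _ h (by omega) (by omega))
    · intro q h1 h2; exact absurd h1.2 h2.2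
    · intro _ q hq; exact hq.2
    · intro q hq; exact hq.2.symm
    · intro q hq
      have := hq.2
      cases hh : sg 0 <;> cases hh' : sg q <;> simp_all
    · cases hh : sg 0 <;> simp
  · push Not at H0
    have : ∃ p q, A p q ∧ 1 ≤ p ∧ p < q ∧ sg p = sg q := by
      obtain ⟨p, q, h, h1, h2, h3⟩ := H0
      rcases lt_or_gt_of_ne (hG.ne _ _ h) with g | g
      · exact ⟨p, q, h, h1, g, h3⟩
      · exact ⟨q, p, hG.symm _ _ h, h2, g, h3.symm⟩
    obtain ⟨p, q, h, hp, hpq, hs⟩ := this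
    left
    have k2 : 1 ≤ gv sg p q 2 := by
      rcases Nat.lt_or_ge p 2 with h2 | h2
      · rw [gv_pass h2 (by omega)]
      · rw [gv_odd h2 hs]; omega
    have c1 := cc_ge1 (sg := sg) hG hpq h 0 1
    have c2 := cc_ge1 (sg := sg) hG hpq h 1 1
    have c3 := cc_ge1 (sg := sg) hG hpq h 0 2
    have c4 := cc_ge1 (sg := sg) hG hpq h 1 2
    rw [gv_odd (Nat.zero_le p) hs] at c1 c3
    rw [gv_odd hp hs] at c1 c2 c4
    refine ⟨by omega, by omega, by omega, by omega⟩

end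


lemma sum_inc (a : ℕ → ℝ) (n p : ℕ) (hp : p < n) :
    ∑ i ∈ Finset.range n, (if i ≤ p then inc a i else 0) = a p := by
  have h1 : ∑ i ∈ Finset.range n, (if i ≤ p then inc a i else 0) = ∑ i ∈ Finset.range (p + 1), inc a i := by
    rw [← Finset.sum_filter]
    refine Finset.sum_congr ?_ fun _ _ => rfl
    ext i
    simp only [Finset.mem_filter, Finset.mem_range]
    omega
  rw [h1]
  clear h1 hp
  induction p with
  | zero => simp [inc]
  | succ p ih =>
    rw [Finset.sum_range_succ, ih, inc, if_neg (by omega), Nat.add_sub_cancel]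
    ring

/-- The quadratic form in terms of absolute values and signs. -/
noncomputable def FF (n : ℕ) (A : ℕ → ℕ → Prop) (sg : ℕ → Bool) (a : ℕ → ℝ) : ℝ :=
  ∑ e ∈ (Finset.range n ×ˢ Finset.range n), if e.1 < e.2 ∧ A e.1 e.2 then
    (if sg e.1 = sg e.2 then a e.1 + a e.2 else a e.2 - a e.1) ^ 2 else 0

lemma gv_sum (sg : ℕ → Bool) (a : ℕ → ℝ) (n p q : ℕ) (hpq : p < q) (hq : q < n) :
    ∑ i ∈ Finset.range n, (gv sg p q i : ℝ) * inc a i = if sg p = sg q then a p + a q else a q - a p := by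
  have h1 := sum_inc a n p (by omega)
  have h2 := sum_inc a n q hq
  have h3 : ∀ i, (gv sg p q i : ℝ) * inc a i = (if i ≤ q then inc a i else 0)
      + (if sg p = sg q then 1 else -1) * (if i ≤ p then inc a i else 0) := by
    intro i
    unfold gv
    by_cases hs : sg p = sg q
    · by_cases ha : i ≤ p
      · rw [if_neg (by omega), if_pos ⟨ha, hs⟩, if_pos (by omega), if_pos hs, if_pos ha]; push_cast; ring
      · by_cases hb : i ≤ q
        · rw [if_pos ⟨by omega, hb⟩, if_pos hb, if_pos hs, if_neg ha]; push_cast; ring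
        · rw [if_neg (by omega), if_neg (by tauto), if_neg hb, if_pos hs, if_neg ha]; push_cast; ring
    · by_cases ha : i ≤ p
      · rw [if_neg (by omega), if_neg (by tauto), if_pos (by omega), if_neg hs, if_pos ha]; push_cast; ring
      · by_cases hb : i ≤ q
        · rw [if_pos ⟨by omega, hb⟩, if_pos hb, if_neg hs, if_neg ha]; push_cast; ring
        · rw [if_neg (by omega), if_neg (by tauto), if_neg hb, if_neg hs, if_neg ha]; push_cast; ring
  simp only [h3, Finset.sum_add_distrib, ← Finset.mul_sum, h1, h2]
  split_ifs <;> ring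

lemma FF_eq (n : ℕ) (A : ℕ → ℕ → Prop) (sg : ℕ → Bool) (a : ℕ → ℝ) :
    FF n A sg a = ∑ i ∈ Finset.range n, ∑ j ∈ Finset.range n, (cc n A sg i j : ℝ) * (inc a i * inc a j) := by
  have h1 : FF n A sg a = ∑ e ∈ (Finset.range n ×ˢ Finset.range n),
      ∑ i ∈ Finset.range n, ∑ j ∈ Finset.range n,
        (if e.1 < e.2 ∧ A e.1 e.2 then ((gv sg e.1 e.2 i : ℝ) * (gv sg e.1 e.2 j : ℝ)) else 0) * (inc a i * inc a j) := by
    unfold FF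
    refine Finset.sum_congr rfl fun e he => ?_
    simp only [Finset.mem_product, Finset.mem_range] at he
    by_cases h : e.1 < e.2 ∧ A e.1 e.2
    · simp only [h, and_self, if_true]
      rw [← gv_sum sg a n e.1 e.2 h.1 he.2, sq, Finset.sum_mul_sum]
      refine Finset.sum_congr rfl fun i _ => Finset.sum_congr rfl fun j _ => ?_
      ring
    · simp [h]
  rw [h1, Finset.sum_comm]
  refine Finset.sum_congr rfl fun i _ => ?_
  rw [Finset.sum_comm]
  refine Finset.sum_congr rfl fun j _ => ?_
  rw [← Finset.sum_mul]
  congr 1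
  unfold cc
  push_cast
  rfl

/-- Banded matrix. -/
noncomputable def bm (d o e : ℕ → ℕ) (i j : ℕ) : ℕ :=
  if j = i then d i else if j = i + 1 then o i else if i = j + 1 then o j
    else if j = i + 2 then e i else if i = j + 2 then e j else 0

lemma bm_sum (d o e : ℕ → ℕ) (k : ℕ) (x : ℕ → ℝ) :
    ∑ i ∈ Finset.range (k + 2), ∑ j ∈ Finset.range (k + 2), (bm d o e i j : ℝ) * (x i * x j)
      = ∑ i ∈ Finset.range (k + 2), (d i : ℝ) * x i ^ 2
        + 2 * ∑ i ∈ Finset.range (k + 1), (o i : ℝ) * (x i * x (i + 1))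
        + 2 * ∑ i ∈ Finset.range k, (e i : ℝ) * (x i * x (i + 2)) := by
  let n := k + 2
  have h1 : ∀ i j, (bm d o e i j : ℝ) * (x i * x j)
      = (if j = i then (d i : ℝ) * x i ^ 2 else 0)
        + (if j = i + 1 then (o i : ℝ) * (x i * x (i + 1)) else 0)
        + (if i = j + 1 then (o j : ℝ) * (x j * x (j + 1)) else 0)
        + (if j = i + 2 then (e i : ℝ) * (x i * x (i + 2)) else 0)
        + (if i = j + 2 then (e j : ℝ) * (x j * x (j + 2)) else 0) := by
    intro i j
    unfold bm
    split_ifs <;> first | (exfalso; omega) | (subst_vars; push_cast; ring)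
  have o1 : ∑ i ∈ Finset.range (k + 2), ∑ j ∈ Finset.range (k + 2),
      (if j = i + 1 then (o i : ℝ) * (x i * x (i + 1)) else 0)
      = ∑ i ∈ Finset.range (k + 1), (o i : ℝ) * (x i * x (i + 1)) := by
    simp only [Finset.sum_ite_eq', Finset.mem_range]
    rw [Finset.sum_range_succ, if_neg (by omega), add_zero]
    refine Finset.sum_congr rfl fun i hi => ?_
    rw [Finset.mem_range] at hi
    rw [if_pos (by omega)]
  have o2 : ∑ i ∈ Finset.range (k + 2), ∑ j ∈ Finset.range (k + 2),
      (if j = i + 2 then (e i : ℝ) * (x i * x (i + 2)) else 0)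
      = ∑ i ∈ Finset.range k, (e i : ℝ) * (x i * x (i + 2)) := by
    simp only [Finset.sum_ite_eq', Finset.mem_range]
    rw [Finset.sum_range_succ, if_neg (by omega), add_zero, Finset.sum_range_succ, if_neg (by omega), add_zero]
    refine Finset.sum_congr rfl fun i hi => ?_
    rw [Finset.mem_range] at hi
    rw [if_pos (by omega)]
  have o0 : ∑ i ∈ Finset.range (k + 2), ∑ j ∈ Finset.range (k + 2),
      (if j = i then (d i : ℝ) * x i ^ 2 else 0) = ∑ i ∈ Finset.range (k + 2), (d i : ℝ) * x i ^ 2 := by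
    simp only [Finset.sum_ite_eq', Finset.mem_range]
    refine Finset.sum_congr rfl fun i hi => ?_
    rw [Finset.mem_range] at hi
    rw [if_pos (by omega)]
  simp only [h1, Finset.sum_add_distrib]
  rw [o0, o1, o2, Finset.sum_comm (f := fun i j => (if i = j + 1 then (o j : ℝ) * (x j * x (j + 1)) else 0)),
    Finset.sum_comm (f := fun i j => (if i = j + 2 then (e j : ℝ) * (x j * x (j + 2)) else 0)), o1, o2]
  ring

lemma band_le {k : ℕ} {A : ℕ → ℕ → Prop} {sg : ℕ → Bool} {a : ℕ → ℝ} (d o e : ℕ → ℕ)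
    (hnn : ∀ i, i < k + 2 → 0 ≤ inc a i)
    (hd : ∀ i, i < k + 2 → d i ≤ cc (k + 2) A sg i i)
    (ho : ∀ i, i < k + 1 → o i ≤ cc (k + 2) A sg i (i + 1))
    (he : ∀ i, i < k → e i ≤ cc (k + 2) A sg i (i + 2)) :
    (∑ i ∈ Finset.range (k + 2), (d i : ℝ) * inc a i ^ 2
        + 2 * ∑ i ∈ Finset.range (k + 1), (o i : ℝ) * (inc a i * inc a (i + 1))
        + 2 * ∑ i ∈ Finset.range k, (e i : ℝ) * (inc a i * inc a (i + 2)) ≤ FF (k + 2) A sg a) ∧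
    (FF (k + 2) A sg a ≤ ∑ i ∈ Finset.range (k + 2), (d i : ℝ) * inc a i ^ 2
        + 2 * ∑ i ∈ Finset.range (k + 1), (o i : ℝ) * (inc a i * inc a (i + 1))
        + 2 * ∑ i ∈ Finset.range k, (e i : ℝ) * (inc a i * inc a (i + 2)) →
      ∀ i j, i < k + 2 → j < k + 2 → 0 < inc a i → 0 < inc a j → cc (k + 2) A sg i j = bm d o e i j) := by
  rw [FF_eq, ← bm_sum]
  have hM : ∀ i j, i < k + 2 → j < k + 2 → bm d o e i j ≤ cc (k + 2) A sg i j := by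
    intro i j hi hj
    unfold bm
    by_cases c1 : j = i
    · subst c1; simpa using hd j hj
    rw [if_neg c1]
    by_cases c2 : j = i + 1
    · subst c2; simpa using ho i (by omega)
    rw [if_neg c2]
    by_cases c3 : i = j + 1
    · subst c3; rw [if_pos rfl, cc_comm]; exact ho j (by omega)
    rw [if_neg c3]
    by_cases c4 : j = i + 2
    · subst c4; rw [if_pos rfl]; exact he i (by omega)
    rw [if_neg c4]
    by_cases c5 : i = j + 2
    · subst c5; rw [if_pos rfl, cc_comm]; exact he j (by omega)
    rw [if_neg c5]
    exact Nat.zero_le _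
  have hterm : ∀ i ∈ Finset.range (k + 2), ∀ j ∈ Finset.range (k + 2),
      (bm d o e i j : ℝ) * (inc a i * inc a j) ≤ (cc (k + 2) A sg i j : ℝ) * (inc a i * inc a j) := by
    intro i hi j hj
    rw [Finset.mem_range] at hi hj
    have := hM i j hi hj
    have h2 : (bm d o e i j : ℝ) ≤ (cc (k + 2) A sg i j : ℝ) := by exact_mod_cast this
    exact mul_le_mul_of_nonneg_right h2 (mul_nonneg (hnn i hi) (hnn j hj))
  refine ⟨Finset.sum_le_sum fun i hi => Finset.sum_le_sum (hterm i hi), ?_⟩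
  intro hle i j hi hj pi pj
  have hi' := Finset.mem_range.mpr hi
  have hj' := Finset.mem_range.mpr hj
  have heq := le_antisymm (Finset.sum_le_sum fun i hi => Finset.sum_le_sum (hterm i hi)) hle
  have e1 := (Finset.sum_eq_sum_iff_of_le fun i hi => Finset.sum_le_sum (hterm i hi)).mp heq i hi'
  have e2 := (Finset.sum_eq_sum_iff_of_le (hterm i hi')).mp e1 j hj'
  have e3 := mul_right_cancel₀ (mul_pos pi pj).ne' e2
  exact_mod_cast e3.symm

/-- The base form on `k + 2` points. -/
noncomputable def form (k : ℕ) (b : ℕ → ℝ) : ℝ :=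
  (b 0 + b 1) ^ 2 + ∑ i ∈ Finset.range k, (b (i + 2) - b i) ^ 2 + (b (k + 1) - b k) ^ 2

/-- Base diagonal. -/
def d0 (i : ℕ) : ℕ := if i = 0 then 4 else 2
/-- Base superdiagonal. -/
def o0 (i : ℕ) : ℕ := if i = 0 then 2 else 1

lemma inc_succ (a : ℕ → ℝ) (i : ℕ) : inc a (i + 1) = a (i + 1) - a i := by
  rw [inc, if_neg (by omega), Nat.add_sub_cancel]

lemma base_form (k : ℕ) (a : ℕ → ℝ) :
    ∑ i ∈ Finset.range (k + 2), (d0 i : ℝ) * inc a i ^ 2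
      + 2 * ∑ i ∈ Finset.range (k + 1), (o0 i : ℝ) * (inc a i * inc a (i + 1)) = form k a := by
  induction k with
  | zero =>
    simp [Finset.sum_range_succ, d0, o0, inc, form]
    ring
  | succ k ih =>
    rw [Finset.sum_range_succ _ (k + 2), Finset.sum_range_succ (fun i => (o0 i : ℝ) * (inc a i * inc a (i + 1))) (k + 1)]
    have e1 : form (k + 1) a = form k a + (a (k + 2) - a k) ^ 2 + (a (k + 2) - a (k + 1)) ^ 2 - (a (k + 1) - a k) ^ 2 := by
      simp only [form, Finset.sum_range_succ]
      ring
    rw [e1, ← ih]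
    have c1 : (d0 (k + 2) : ℝ) = 2 := by simp [d0]
    have c2 : (o0 (k + 1) : ℝ) = 1 := by simp [o0]
    rw [show k + 1 + 1 = k + 2 from rfl, c1, c2, inc_succ a k, inc_succ a (k + 1)]
    ring

/-- Removing one entry of a sequence. -/
def skip (r : ℕ) (a : ℕ → ℝ) (i : ℕ) : ℝ := if i < r then a i else a (i + 1)

lemma skip_lt {r i : ℕ} (a : ℕ → ℝ) (h : i < r) : skip r a i = a i := by simp [skip, h]
lemma skip_ge {r i : ℕ} (a : ℕ → ℝ) (h : r ≤ i) : skip r a i = a (i + 1) := by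
  simp [skip, Nat.not_lt.mpr h]

lemma skip_step (r k : ℕ) (hk : r ≤ k) (a : ℕ → ℝ) (X : ℝ) (h : form k (skip r a) = form (k + 1) a + X) :
    form (k + 1) (skip r a) = form (k + 2) a + X := by
  have e1 : ∀ b : ℕ → ℝ, ∀ k, form (k + 1) b = form k b + (b (k + 2) - b k) ^ 2 + (b (k + 2) - b (k + 1)) ^ 2 - (b (k + 1) - b k) ^ 2 := by
    intro b k
    simp only [form, Finset.sum_range_succ]
    ring
  rw [e1, h, e1 a (k + 1), skip_ge a (by omega), skip_ge a (by omega), skip_ge a (by omega)]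
  ring

lemma skip_form (r k : ℕ) (hk : r ≤ k) (a : ℕ → ℝ) (X : ℝ) (h : form r (skip r a) = form (r + 1) a + X) :
    form k (skip r a) = form (k + 1) a + X := by
  induction k, hk using Nat.le_induction with
  | base => exact h
  | succ k hk ih => exact skip_step r k hk a X ih

lemma skip_form0 (k : ℕ) (a : ℕ → ℝ) :
    form k (skip 0 a) = form (k + 1) a + (4 * (inc a 0 * inc a 1) + 2 * inc a 1 ^ 2 + 4 * (inc a 0 * inc a 2)
      + 2 * (inc a 1 * inc a 2)) := by
  apply skip_form _ _ (Nat.zero_le k)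
  simp [form, skip, inc]
  ring

lemma skip_form1 (k : ℕ) (hk : 1 ≤ k) (a : ℕ → ℝ) :
    form k (skip 1 a) = form (k + 1) a + (2 * (inc a 1 * inc a 2) + 4 * (inc a 0 * inc a 2) + 2 * (inc a 1 * inc a 3)) := by
  apply skip_form _ _ hk
  simp [form, skip, inc, Finset.sum_range_succ]
  ring

lemma skip_form2 (r k : ℕ) (hk : r + 2 ≤ k) (a : ℕ → ℝ) :
    form k (skip (r + 2) a) = form (k + 1) a + (2 * (inc a (r + 2) * inc a (r + 3)) + 2 * (inc a (r + 1) * inc a (r + 3))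
      + 2 * (inc a (r + 2) * inc a (r + 4))) := by
  apply skip_form _ _ hk
  simp only [form, Finset.sum_range_succ, inc_succ]
  rw [skip_lt a (by omega : 0 < r + 2), skip_lt a (by omega : 1 < r + 2), skip_lt a (by omega : r < r + 2),
    skip_lt a (by omega : r + 1 < r + 2), skip_ge a (by omega : r + 2 ≤ r + 2), skip_ge a (by omega : r + 2 ≤ r + 2 + 1)]
  have : ∑ x ∈ Finset.range r, (skip (r + 2) a (x + 2) - skip (r + 2) a x) ^ 2 = ∑ x ∈ Finset.range r, (a (x + 2) - a x) ^ 2 := by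
    refine Finset.sum_congr rfl fun x hx => ?_
    rw [Finset.mem_range] at hx
    rw [skip_lt a (by omega), skip_lt a (by omega)]
  rw [this]
  ring_nf

lemma skip_formB (k : ℕ) (a : ℕ → ℝ) :
    form (k + 1) (skip (k + 2) a) + (a (k + 2) - a (k + 1)) ^ 2 + (a (k + 2) - a k) ^ 2
      = form (k + 2) a + (inc a (k + 1) ^ 2 + 2 * inc a (k + 2) ^ 2 + 2 * (inc a (k + 1) * inc a (k + 2))
        + 2 * (inc a (k + 1) * inc a (k + 3)) + 2 * (inc a (k + 2) * inc a (k + 3))) := by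
  simp only [form, Finset.sum_range_succ, inc_succ]
  rw [skip_lt a (by omega : 0 < k + 2), skip_lt a (by omega : 1 < k + 2), skip_lt a (by omega : k < k + 2),
    skip_lt a (by omega : k + 1 < k + 2), skip_ge a (by omega : k + 2 ≤ k + 2)]
  have : ∑ x ∈ Finset.range k, (skip (k + 2) a (x + 2) - skip (k + 2) a x) ^ 2 = ∑ x ∈ Finset.range k, (a (x + 2) - a x) ^ 2 := by
    refine Finset.sum_congr rfl fun x hx => ?_
    rw [Finset.mem_range] at hx
    rw [skip_lt a (by omega), skip_lt a (by omega)]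
  rw [this]
  ring_nf

lemma skip_mass (r k : ℕ) (hr : r ≤ k) (a : ℕ → ℝ) :
    ∑ i ∈ Finset.range k, skip r a i ^ 2 = ∑ i ∈ Finset.range (k + 1), a i ^ 2 - a r ^ 2 := by
  induction k, hr using Nat.le_induction with
  | base =>
    rw [Finset.sum_range_succ]
    have : ∑ i ∈ Finset.range r, skip r a i ^ 2 = ∑ i ∈ Finset.range r, a i ^ 2 := by
      refine Finset.sum_congr rfl fun x hx => ?_
      rw [Finset.mem_range] at hx
      rw [skip_lt a hx]
    rw [this]; ring
  | succ k hk ih =>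
    rw [Finset.sum_range_succ, Finset.sum_range_succ _ (k + 1), ih, skip_ge a hk]
    ring

lemma form_trhs (q : ℕ) (b : ℕ → ℝ) (t : ℝ) :
    trhs q (fun j => b (2 * j + 1)) (fun j => b (2 * j)) (b (2 * q + 2)) t
      = form (2 * q + 1) b + (t - b (2 * q + 1)) ^ 2 + (t - b (2 * q)) ^ 2 := by
  have h : ∀ q, ∑ i ∈ Finset.range (2 * q), (b (i + 2) - b i) ^ 2
      = ∑ j ∈ Finset.range q, ((b (2 * (j + 1) + 1) - b (2 * j + 1)) ^ 2 + (b (2 * (j + 1)) - b (2 * j)) ^ 2) := by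
    intro q
    induction q with
    | zero => simp
    | succ q ih =>
      rw [show 2 * (q + 1) = 2 * q + 1 + 1 by ring, Finset.sum_range_succ, Finset.sum_range_succ, ih,
        Finset.sum_range_succ _ q]
      rw [show 2 * (q + 1) + 1 = 2 * q + 1 + 2 by ring, show 2 * (q + 1) = 2 * q + 2 by ring]
      ring
  simp only [form, trhs]
  rw [Finset.sum_range_succ, h]
  simp only [mul_zero, zero_add]
  ring

lemma mass_tmass (q : ℕ) (b : ℕ → ℝ) (t : ℝ) :
    tmass q (fun j => b (2 * j + 1)) (fun j => b (2 * j)) (b (2 * q + 2)) t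
      = ∑ i ∈ Finset.range (2 * q + 3), b i ^ 2 + t ^ 2 := by
  have h : ∀ q, ∑ i ∈ Finset.range (2 * q), b i ^ 2
      = ∑ j ∈ Finset.range q, (b (2 * j + 1) ^ 2 + b (2 * j) ^ 2) := by
    intro q
    induction q with
    | zero => simp
    | succ q ih =>
      rw [show 2 * (q + 1) = 2 * q + 1 + 1 by ring, Finset.sum_range_succ, Finset.sum_range_succ, ih,
        Finset.sum_range_succ _ q]
      ring
  rw [tmass, show 2 * q + 3 = 2 * (q + 1) + 1 by ring, Finset.sum_range_succ _ (2 * (q + 1)), h]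
  rw [show 2 * (q + 1) = 2 * q + 2 by ring]


lemma sum_extra (m ρ c : ℕ) (hρ : ρ < m) (g : ℕ → ℕ) (f : ℕ → ℝ) :
    ∑ i ∈ Finset.range m, ((g i + (if i = ρ then c else 0) : ℕ) : ℝ) * f i
      = ∑ i ∈ Finset.range m, (g i : ℝ) * f i + c * f ρ := by
  have : ∀ i, ((g i + (if i = ρ then c else 0) : ℕ) : ℝ) * f i = (g i : ℝ) * f i + (if i = ρ then (c : ℝ) * f i else 0) := by
    intro i; split_ifs <;> push_cast <;> ring
  simp only [this, Finset.sum_add_distrib, Finset.sum_ite_eq', Finset.mem_range, hρ, if_true]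

lemma sum_zero' (m : ℕ) (f : ℕ → ℝ) : ∑ i ∈ Finset.range m, ((0 : ℕ) : ℝ) * f i = 0 := by simp

/-- Diagonal in case B. -/
def dB (q i : ℕ) : ℕ := (d0 i + if i = 2 * q + 1 then 1 else 0) + if i = 2 * q + 2 then 2 else 0
/-- Superdiagonal in case B. -/
def oB (q i : ℕ) : ℕ := (o0 i + if i = 2 * q + 1 then 1 else 0) + if i = 2 * q + 2 then 1 else 0
/-- Second superdiagonal in case B. -/
def eB (q i : ℕ) : ℕ := 0 + if i = 2 * q + 1 then 1 else 0

lemma cases_bound {q : ℕ} {A : ℕ → ℕ → Prop} (hG : OGraph (2 * q + 4) A) (sg : ℕ → Bool) (a : ℕ → ℝ)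
    (hnn : ∀ i, i < 2 * q + 4 → 0 ≤ inc a i) :
    form (2 * q + 2) a ≤ FF (2 * q + 4) A sg a ∧
    ((∃ r, r ≤ 2 * q ∧ form (2 * q + 1) (skip r a) ≤ FF (2 * q + 4) A sg a) ∨
    (form (2 * q + 1) (skip (2 * q + 1) a) + (a (2 * q + 1) - a (2 * q + 2)) ^ 2 + (a (2 * q + 1) - a (2 * q)) ^ 2
      ≤ FF (2 * q + 4) A sg a) ∨
    (form (2 * q + 1) (skip (2 * q + 2) a) + (a (2 * q + 2) - a (2 * q + 1)) ^ 2 + (a (2 * q + 2) - a (2 * q)) ^ 2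
      ≤ FF (2 * q + 4) A sg a ∧
      (FF (2 * q + 4) A sg a ≤ form (2 * q + 1) (skip (2 * q + 2) a) + (a (2 * q + 2) - a (2 * q + 1)) ^ 2
        + (a (2 * q + 2) - a (2 * q)) ^ 2 →
        ∀ i j, i < 2 * q + 4 → j < 2 * q + 4 → 0 < inc a i → 0 < inc a j →
          cc (2 * q + 4) A sg i j = bm (dB q) (oB q) (eB q) i j))) := by
  obtain ⟨b00, b01, bii, bi1⟩ := cc_base hG sg
  have hd0 : ∀ i, i < 2 * q + 4 → d0 i ≤ cc (2 * q + 4) A sg i i := by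
    intro i hi
    unfold d0
    split_ifs with h
    · subst h; exact b00
    · exact bii i (by omega) hi
  have ho0 : ∀ i, i < 2 * q + 3 → o0 i ≤ cc (2 * q + 4) A sg i (i + 1) := by
    intro i hi
    unfold o0
    split_ifs with h
    · subst h; exact b01
    · exact bi1 i (by omega) (by omega)
  have d0s : ∀ i, d0 (i + 1) = 2 := fun i => by simp [d0]
  have o0s : ∀ i, o0 (i + 1) = 1 := fun i => by simp [o0]
  constructor
  · have := (band_le (A := A) (sg := sg) (a := a) (k := 2 * q + 2) d0 o0 (fun _ => 0) hnn hd0 ho0 (fun i _ => Nat.zero_le _)).1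
    rw [sum_zero', base_form] at this
    simpa using this
  rcases comb hG sg with ⟨c1, c2, c3, c4⟩ | ⟨r, hr, c1, c2, c3⟩ | ⟨r, hr, c1, c2, c3, c4, c5⟩ | ⟨r, hr, c1, c2, c3, c4, c5⟩
  · -- r = 0
    left
    refine ⟨0, Nat.zero_le _, ?_⟩
    have := (band_le (A := A) (sg := sg) (a := a) (k := 2 * q + 2) (fun i => d0 i + if i = 1 then 2 else 0)
      (fun i => (o0 i + if i = 0 then 2 else 0) + if i = 1 then 1 else 0) (fun i => 0 + if i = 0 then 2 else 0) hnn ?_ ?_ ?_).1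
    · rw [sum_extra _ _ _ (by omega), sum_extra _ _ _ (by omega), sum_extra _ _ _ (by omega),
        sum_extra _ _ _ (by omega), sum_zero'] at this
      have hb := base_form (2 * q + 2) a
      rw [skip_form0, ← hb]
      push_cast at this
      simp only [zero_add] at this
      norm_num at this ⊢
      linarith
    · intro i hi
      by_cases h : i = 1
      · subst h; simp [d0]; omega
      · simpa [h] using hd0 i hi
    · intro i hi
      by_cases h : i = 0
      · subst h; simp [o0]; omega
      by_cases h1 : i = 1
      · subst h1; simp [o0]; omega
      simpa [h, h1] using ho0 i hi
    · intro i hi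
      by_cases h : i = 0
      · subst h; simp; omega
      · simp [h]
  · left
    refine ⟨r + 1, by omega, ?_⟩
    have := (band_le (A := A) (sg := sg) (a := a) (k := 2 * q + 2) d0 (fun i => o0 i + if i = r + 1 then 1 else 0)
      (fun i => (0 + if i = r then (if r = 0 then 2 else 1) else 0) + if i = r + 1 then 1 else 0) hnn hd0 ?_ ?_).1
    · rw [sum_extra _ _ _ (by omega), sum_extra _ _ _ (by omega), sum_extra _ _ _ (by omega), sum_zero'] at this
      have hb := base_form (2 * q + 2) a
      rcases r with _ | r
      · rw [skip_form1 _ (by omega), ← hb]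
        push_cast at this
        simp only [zero_add] at this
        norm_num at this ⊢
        linarith
      · rw [skip_form2 _ _ (by omega), ← hb]
        rw [if_neg (by omega)] at this
        push_cast at this
        simp only [zero_add] at this
        norm_num at this ⊢
        linarith
    · intro i hi
      by_cases h : i = r + 1
      · subst h; simp [o0]; omega
      simpa [h] using ho0 i hi
    · intro i hi
      by_cases h : i = r
      · subst h; simpa using c2
      by_cases h1 : i = r + 1
      · subst h1; simpa using c3
      simp [h, h1]
  · right; left
    have hrq : r = 2 * q := by omega
    subst hrq
    have := (band_le (A := A) (sg := sg) (a := a) (k := 2 * q + 2) (fun i => (d0 i + if i = 2 * q + 1 then 1 else 0) + if i = 2 * q + 2 then 1 else 0)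
      (fun i => o0 i + if i = 2 * q + 1 then 1 else 0)
      (fun i => (0 + if i = 2 * q then (if 2 * q = 0 then 2 else 1) else 0) + if i = 2 * q + 1 then 1 else 0) hnn ?_ ?_ ?_).1
    · rw [sum_extra _ _ _ (by omega), sum_extra _ _ _ (by omega), sum_extra _ _ _ (by omega), sum_extra _ _ _ (by omega),
        sum_extra _ _ _ (by omega), sum_zero'] at this
      have hb := base_form (2 * q + 2) a
      have x1 := inc_succ a (2 * q)
      have x2 := inc_succ a (2 * q + 1)
      have e1 : (a (2 * q + 1) - a (2 * q + 2)) ^ 2 = inc a (2 * q + 2) ^ 2 := by rw [x2]; ring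
      have e2 : (a (2 * q + 1) - a (2 * q)) ^ 2 = inc a (2 * q + 1) ^ 2 := by rw [x1]
      rw [e1, e2]
      rcases q with _ | q
      · rw [skip_form1 _ (by omega), ← hb]
        push_cast at this
        simp only [zero_add] at this
        norm_num at this ⊢
        linarith
      · have hsk : form (2 * (q + 1) + 1) (skip (2 * (q + 1) + 1) a) = form (2 * (q + 1) + 2) a
            + (2 * (inc a (2 * (q + 1) + 1) * inc a (2 * (q + 1) + 2)) + 2 * (inc a (2 * (q + 1)) * inc a (2 * (q + 1) + 2))
            + 2 * (inc a (2 * (q + 1) + 1) * inc a (2 * (q + 1) + 3))) :=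
          skip_form2 (2 * q + 1) (2 * (q + 1) + 1) (by omega) a
        rw [hsk, ← hb]
        rw [if_neg (by omega)] at this
        generalize 2 * (q + 1) = m at *
        push_cast at this
        simp only [add_assoc] at this ⊢
        norm_num at this ⊢
        linarith
    · intro i hi
      by_cases h : i = 2 * q + 1
      · subst h; simp [d0]; omega
      by_cases h1 : i = 2 * q + 2
      · subst h1; simp [d0]; omega
      simpa [h, h1] using hd0 i hi
    · intro i hi
      by_cases h : i = 2 * q + 1
      · subst h; simp [o0]; omega
      simpa [h] using ho0 i hi
    · intro i hi
      by_cases h : i = 2 * q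
      · subst h; simpa using c2
      by_cases h1 : i = 2 * q + 1
      · subst h1; simpa using c3
      simp [h, h1]
  · right; right
    have hrq : r = 2 * q := by omega
    subst hrq
    have key := band_le (A := A) (sg := sg) (a := a) (k := 2 * q + 2) (dB q) (oB q) (eB q) hnn ?_ ?_ ?_
    · have hs : ∑ i ∈ Finset.range (2 * q + 2 + 2), (dB q i : ℝ) * inc a i ^ 2
          + 2 * ∑ i ∈ Finset.range (2 * q + 2 + 1), (oB q i : ℝ) * (inc a i * inc a (i + 1))
          + 2 * ∑ i ∈ Finset.range (2 * q + 2), (eB q i : ℝ) * (inc a i * inc a (i + 2))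
          = form (2 * q + 1) (skip (2 * q + 2) a) + (a (2 * q + 2) - a (2 * q + 1)) ^ 2 + (a (2 * q + 2) - a (2 * q)) ^ 2 := by
        unfold dB oB eB
        rw [sum_extra _ _ _ (by omega), sum_extra _ _ _ (by omega), sum_extra _ _ _ (by omega), sum_extra _ _ _ (by omega),
          sum_extra _ _ _ (by omega), sum_zero']
        have hb := base_form (2 * q + 2) a
        rw [skip_formB, ← hb]
        push_cast
        ring
      rw [hs] at key
      exact key
    · intro i hi
      unfold dB
      by_cases h : i = 2 * q + 1
      · subst h; simp [d0]; omega
      by_cases h1 : i = 2 * q + 2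
      · subst h1; simp [d0]; omega
      simpa [h, h1] using hd0 i hi
    · intro i hi
      unfold oB
      by_cases h : i = 2 * q + 1
      · subst h; simp [o0]; omega
      by_cases h1 : i = 2 * q + 2
      · subst h1; simp [o0]; omega
      simpa [h, h1] using ho0 i hi
    · intro i hi
      unfold eB
      by_cases h1 : i = 2 * q + 1
      · subst h1; simpa using c2
      simp [h1]


set_option maxHeartbeats 2000000 in
lemma analytic {q : ℕ} {A : ℕ → ℕ → Prop} (hG : OGraph (2 * q + 4) A) (sg : ℕ → Bool) (a : ℕ → ℝ) (lam μ : ℝ)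
    (hnn : ∀ i, i < 2 * q + 4 → 0 ≤ inc a i) (htop : 0 < a (2 * q + 3))
    (hFF : FF (2 * q + 4) A sg a ≤ μ * ∑ i ∈ Finset.range (2 * q + 4), a i ^ 2)
    (hT : TestIneq q lam)
    (hev : (a (2 * q + 3) - a (2 * q + 2)) + (a (2 * q + 3) - a (2 * q + 1)) ≤ μ * a (2 * q + 3)) :
    lam ≤ μ ∧ (lam = μ → ∀ i j, i ≤ q + 1 → j ≤ q + 1 →
      cc (2 * q + 4) A sg (2 * i) (2 * j) = bm (dB q) (oB q) (eB q) (2 * i) (2 * j)) := by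
  have hstep : ∀ i, i + 1 < 2 * q + 4 → a i ≤ a (i + 1) := by
    intro i hi
    have := hnn (i + 1) hi
    rw [inc_succ] at this; linarith
  have h0 : 0 ≤ a 0 := by simpa [inc] using hnn 0 (by omega)
  have hmono : ∀ d i, i + d < 2 * q + 4 → a i ≤ a (i + d) := by
    intro d
    induction d with
    | zero => intro i _; exact le_rfl
    | succ d ih => intro i hi; exact (ih i (by omega)).trans (hstep (i + d) (by omega))
  have hm : ∀ i j, i ≤ j → j < 2 * q + 4 → a i ≤ a j := by
    intro i j hij hj
    have := hmono (j - i) i (by omega)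
    rwa [Nat.add_sub_cancel' hij] at this
  have hpos : ∀ i, i < 2 * q + 4 → 0 ≤ a i := fun i hi => h0.trans (hm 0 i (Nat.zero_le _) hi)
  obtain ⟨hf, hc⟩ := cases_bound hG sg a hnn
  have hS : a (2 * q + 3) ^ 2 ≤ ∑ i ∈ Finset.range (2 * q + 4), a i ^ 2 :=
    Finset.single_le_sum (f := fun i => a i ^ 2) (fun i _ => sq_nonneg _) (Finset.mem_range.2 (by omega))
  have hSpos : 0 < ∑ i ∈ Finset.range (2 * q + 4), a i ^ 2 := lt_of_lt_of_le (by positivity) hS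
  have hμ : 0 < μ := by
    by_contra hneg
    push Not at hneg
    have h1 : form (2 * q + 2) a ≤ 0 := by
      have := mul_nonneg (neg_nonneg.2 hneg) hSpos.le
      linarith
    unfold form at h1
    have t1 := sq_nonneg (a 0 + a 1)
    have t3 := sq_nonneg (a (2 * q + 2 + 1) - a (2 * q + 2))
    have t2 : 0 ≤ ∑ i ∈ Finset.range (2 * q + 2), (a (i + 2) - a i) ^ 2 := Finset.sum_nonneg fun _ _ => sq_nonneg _
    have e1 : a 0 + a 1 = 0 := by
      have : (a 0 + a 1) ^ 2 = 0 := by linarith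
      exact pow_eq_zero_iff (two_ne_zero) |>.1 this
    have e2 : ∑ i ∈ Finset.range (2 * q + 2), (a (i + 2) - a i) ^ 2 = 0 := by linarith
    rw [Finset.sum_eq_zero_iff_of_nonneg (fun _ _ => sq_nonneg _)] at e2
    have e3 : ∀ i, i < 2 * q + 3 → a i = 0 ∧ a (i + 1) = 0 := by
      intro i
      induction i with
      | zero =>
        intro _
        have := hpos 1 (by omega)
        exact ⟨by linarith, by simp only [zero_add]; linarith⟩
      | succ i ih =>
        intro hi
        have h := ih (by omega)
        have h' := e2 i (Finset.mem_range.2 (by omega))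
        have h'' := pow_eq_zero_iff (two_ne_zero) |>.1 h'
        exact ⟨h.2, by rw [show i + 1 + 1 = i + 2 by ring]; linarith [h.1]⟩
    have := (e3 (2 * q + 2) (by omega)).2
    rw [show 2 * q + 2 + 1 = 2 * q + 3 by ring] at this
    linarith
  have k1 := hstep (2 * q + 1) (by omega)
  have k2 := hstep (2 * q + 2) (by omega)
  rw [show 2 * q + 1 + 1 = 2 * q + 2 by ring] at k1
  rw [show 2 * q + 2 + 1 = 2 * q + 3 by ring] at k2
  rcases hc with ⟨r, hr, hb⟩ | hb | ⟨hb, hbeq⟩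
  · have b2 : skip r a (2 * q + 2) = a (2 * q + 3) := skip_ge a (by omega)
    have b1 : skip r a (2 * q + 1) = a (2 * q + 2) := skip_ge a (by omega)
    have b0 : skip r a (2 * q) = a (2 * q + 1) := skip_ge a (by omega)
    have hr1 : 0 ≤ a r := hpos r (by omega)
    have hr2 : a r ≤ a (2 * q + 1) := hm _ _ (by omega) (by omega)
    have hform := form_trhs q (skip r a) (a (2 * q + 3))
    have hmass := mass_tmass q (skip r a) (a (2 * q + 3))
    rw [skip_mass r (2 * q + 3) (by omega) a] at hmass
    have ht := hT (fun j => skip r a (2 * j + 1)) (fun j => skip r a (2 * j)) (skip r a (2 * q + 2)) (a (2 * q + 3))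
    rw [show 2 * q + 3 + 1 = 2 * q + 4 by ring] at hmass
    set M := tmass q (fun j => skip r a (2 * j + 1)) (fun j => skip r a (2 * j)) (skip r a (2 * q + 2)) (a (2 * q + 3)) with hMdef
    set T := trhs q (fun j => skip r a (2 * j + 1)) (fun j => skip r a (2 * j)) (skip r a (2 * q + 2)) (a (2 * q + 3)) with hTdef
    set S := ∑ i ∈ Finset.range (2 * q + 4), a i ^ 2 with hSdef
    rw [b1, b0] at hform
    obtain ⟨t, htt⟩ : ∃ t, t = a (2 * q + 3) := ⟨_, rfl⟩
    have hy : 0 ≤ a (2 * q + 2) - a (2 * q + 1) := by linarith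
    have hz : 0 ≤ a (2 * q + 3) - a (2 * q + 2) := by linarith
    have hyz : 0 ≤ a (2 * q + 3) - a (2 * q + 1) := by linarith
    have q1 : (a (2 * q + 3) - a (2 * q + 2)) ^ 2 + (a (2 * q + 3) - a (2 * q + 1)) ^ 2 ≤
        ((a (2 * q + 3) - a (2 * q + 2)) + (a (2 * q + 3) - a (2 * q + 1))) * (a (2 * q + 3) - a (2 * q + 1)) := by
      nlinarith [mul_nonneg hy hz]
    have q2 := mul_le_mul_of_nonneg_right hev hyz
    have q3 : a (2 * q + 3) * (a (2 * q + 3) - a (2 * q + 1)) ≤ a (2 * q + 3) ^ 2 - a r ^ 2 := by nlinarith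
    have q4 := mul_le_mul_of_nonneg_left q3 hμ.le
    have hTM : T ≤ μ * M := by
      rw [hform, hmass]
      nlinarith
    have hMpos : 0 < M := by
      rw [hmass]
      have : a r ^ 2 ≤ a (2 * q + 3) ^ 2 := by nlinarith
      linarith
    refine ⟨le_of_mul_le_mul_right (ht.trans hTM) hMpos, ?_⟩
    intro hlm
    exfalso
    subst hlm
    obtain ⟨e1, e2, e3, e4, e5⟩ := test_eq hT hμ _ _ _ _ hTM (fun j hj => by
      show 0 ≤ skip r a (2 * j + 1)
      unfold skip
      split_ifs
      · exact hpos _ (by omega)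
      · exact hpos _ (by omega)) (by rw [b2]; exact htop.le) (by rw [b2]; exact htop.ne')
    have y0 := e1 q le_rfl
    simp only [b0, b1] at y0
    simp only [b1, b2] at e5
    simp only [mul_zero, zero_add] at e3
    have a2 : 0 < a (2 * q + 2) := by
      have : skip r a 1 ≤ a (2 * q + 2) := by
        unfold skip
        split_ifs
        · exact hm _ _ (by omega) (by omega)
        · exact hm _ _ (by omega) (by omega)
      linarith
    rw [← y0] at a2 e5 hform hev
    have hz' : 0 < a (2 * q + 3) - a (2 * q + 1) := by linarith
    have p1 := mul_le_mul_of_nonneg_right hev hz'.le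
    have p2 : 0 < lam * a (2 * q + 1) * (a (2 * q + 3) - a (2 * q + 1)) := by positivity
    have p3 : lam * a r ^ 2 ≤ lam * a (2 * q + 1) ^ 2 := mul_le_mul_of_nonneg_left (pow_le_pow_left₀ hr1 hr2 2) hμ.le
    have : T < lam * M := by
      rw [hform, hmass]
      nlinarith
    linarith
  · have b2 : skip (2 * q + 1) a (2 * q + 2) = a (2 * q + 3) := skip_ge a (by omega)
    have b1 : skip (2 * q + 1) a (2 * q + 1) = a (2 * q + 2) := skip_ge a (by omega)
    have b0 : skip (2 * q + 1) a (2 * q) = a (2 * q) := skip_lt a (by omega)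
    have hform := form_trhs q (skip (2 * q + 1) a) (a (2 * q + 1))
    have hmass := mass_tmass q (skip (2 * q + 1) a) (a (2 * q + 1))
    rw [skip_mass (2 * q + 1) (2 * q + 3) (by omega) a, show 2 * q + 3 + 1 = 2 * q + 4 by ring] at hmass
    have ht := hT (fun j => skip (2 * q + 1) a (2 * j + 1)) (fun j => skip (2 * q + 1) a (2 * j))
      (skip (2 * q + 1) a (2 * q + 2)) (a (2 * q + 1))
    rw [b1, b0] at hform
    rw [hform, hmass, sub_add_cancel] at ht
    refine ⟨le_of_mul_le_mul_right (ht.trans (hb.trans hFF)) hSpos, ?_⟩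
    intro hlm
    exfalso
    subst hlm
    obtain ⟨e1, e2, e3, e4, e5⟩ := test_eq hT hμ (fun j => skip (2 * q + 1) a (2 * j + 1)) (fun j => skip (2 * q + 1) a (2 * j))
      (skip (2 * q + 1) a (2 * q + 2)) (a (2 * q + 1)) (by rw [hform, hmass, sub_add_cancel]; exact hb.trans hFF) (fun j hj => by
      show 0 ≤ skip _ a (2 * j + 1)
      unfold skip
      split_ifs
      · exact hpos _ (by omega)
      · exact hpos _ (by omega)) (by rw [b2]; exact htop.le) (by rw [b2]; exact htop.ne')
    simp only [b1, b2] at e5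
    rw [b2] at e2
    linarith
  · have b2 : skip (2 * q + 2) a (2 * q + 2) = a (2 * q + 3) := skip_ge a (by omega)
    have b1 : ∀ j, j ≤ q → skip (2 * q + 2) a (2 * j + 1) = a (2 * j + 1) := fun j hj => skip_lt a (by omega)
    have b0 : ∀ j, j ≤ q → skip (2 * q + 2) a (2 * j) = a (2 * j) := fun j hj => skip_lt a (by omega)
    have hform := form_trhs q (skip (2 * q + 2) a) (a (2 * q + 2))
    have hmass := mass_tmass q (skip (2 * q + 2) a) (a (2 * q + 2))
    rw [skip_mass (2 * q + 2) (2 * q + 3) (by omega) a, show 2 * q + 3 + 1 = 2 * q + 4 by ring] at hmass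
    have ht := hT (fun j => skip (2 * q + 2) a (2 * j + 1)) (fun j => skip (2 * q + 2) a (2 * j))
      (skip (2 * q + 2) a (2 * q + 2)) (a (2 * q + 2))
    rw [b1 q le_rfl, b0 q le_rfl] at hform
    rw [hform, hmass, sub_add_cancel] at ht
    refine ⟨le_of_mul_le_mul_right (ht.trans (hb.trans hFF)) hSpos, ?_⟩
    intro hlm
    subst hlm
    obtain ⟨e1, e2, e3, e4, e5⟩ := test_eq hT hμ (fun j => skip (2 * q + 2) a (2 * j + 1)) (fun j => skip (2 * q + 2) a (2 * j))
      (skip (2 * q + 2) a (2 * q + 2)) (a (2 * q + 2)) (by rw [hform, hmass, sub_add_cancel]; exact hb.trans hFF) (fun j hj => by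
      show 0 ≤ skip _ a (2 * j + 1)
      rw [b1 j hj]
      exact hpos _ (by omega)) (by rw [b2]; exact htop.le) (by rw [b2]; exact htop.ne')
    have key := hbeq (hFF.trans ht)
    have hinc : ∀ i, i ≤ q + 1 → 0 < inc a (2 * i) := by
      intro i hi
      rcases i with _ | i
      · have h1 := e1 0 (by omega)
        have h2 := b0 0 (by omega)
        have h3 := b1 0 (by omega)
        simp only [mul_zero, zero_add] at h1 h2 h3 e3
        simp only [mul_zero, inc, if_true]
        linarith
      · rw [show 2 * (i + 1) = 2 * i + 1 + 1 by ring, inc_succ]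
        rcases Nat.lt_or_ge i q with h | h
        · have h1 := e4 i h
          have h2 := e1 (i + 1) (by omega)
          simp only [b1 i (by omega), b1 (i + 1) (by omega), b0 (i + 1) (by omega)] at h1 h2
          rw [show 2 * (i + 1) = 2 * i + 1 + 1 by ring] at h1 h2
          linarith
        · have : i = q := by omega
          subst this
          simp only [b1 i le_rfl] at e5
          rw [← e2] at e5
          rw [show 2 * i + 1 + 1 = 2 * i + 2 by ring]
          linarith
    intro i j hi hj
    exact key _ _ (by omega) (by omega) (hinc i hi) (hinc j hj)


lemma sign_odd {n : ℕ} {A : ℕ → ℕ → Prop} (hG : OGraph n A) (sg : ℕ → Bool) (h02 : cc n A sg 0 2 = 0)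
    (u w : ℕ) (h : A u w) (hs : sg u = sg w) : (u = 0 ∧ w = 1) ∨ (u = 1 ∧ w = 0) := by
  have main : ∀ u w, A u w → u < w → sg u = sg w → u = 0 ∧ w = 1 := by
    intro u w h huw hs
    by_contra hc
    have h1 := cc_ge1 (sg := sg) hG huw h 0 2
    rw [h02, gv_odd (Nat.zero_le _) hs] at h1
    rcases Nat.lt_or_ge u 2 with h2 | h2
    · rw [gv_pass h2 (by omega)] at h1; omega
    · rw [gv_odd h2 hs] at h1; omega
  rcases lt_or_gt_of_ne (hG.ne _ _ h) with g | g
  · exact Or.inl (main u w h g hs)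
  · have := main w u (hG.symm _ _ h) g hs.symm
    exact Or.inr ⟨this.2, this.1⟩

/-- Bit of a Boolean. -/
def bit (s : Bool) : ℕ := if s then 1 else 0

lemma gap_match {n : ℕ} {A : ℕ → ℕ → Prop} (hG : OGraph n A) (sg : ℕ → Bool) (i : ℕ) (hi : 2 * i + 3 < n)
    (hlev : ∀ u w, A u w → u < w → w / 2 ≤ u / 2 + 1)
    (h2 : cc n A sg (2 * i + 2) (2 * i + 2) = 2) :
    ∃ w : Bool, ∀ s t, A (2 * i + bit s) (2 * (i + 1) + bit t) ↔ xor s t = w := by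
  have hcross : ∀ u w, A u w → u ≤ 2 * i + 1 → 2 * i + 1 < w →
      (u = 2 * i ∨ u = 2 * i + 1) ∧ (w = 2 * i + 2 ∨ w = 2 * i + 3) := by
    intro u w h h1 h2
    have := hlev u w h (by omega)
    omega
  have h3 : ∀ p w p' w' p'' w'', A p w → A p' w' → A p'' w'' → p ≤ 2 * i + 1 → 2 * i + 1 < w →
      p' ≤ 2 * i + 1 → 2 * i + 1 < w' → p'' ≤ 2 * i + 1 → 2 * i + 1 < w'' →
      (p ≠ p' ∨ w ≠ w') → (p ≠ p'' ∨ w ≠ w'') → (p' ≠ p'' ∨ w' ≠ w'') → False := by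
    intro p w p' w' p'' w'' a1 a2 a3 b1 b2 b3 b4 b5 b6 c1 c2 c3
    have := cc_ge3 (sg := sg) hG (by omega : p < w) a1 (by omega : p' < w') a2 (by omega : p'' < w'') a3 c1 c2 c3
      (2 * i + 2) (2 * i + 2)
    rw [h2, gv_pass (by omega) (by omega), gv_pass (by omega) (by omega), gv_pass (by omega) (by omega)] at this
    omega
  obtain ⟨u1, w1, a1, a2, a3, a4, a5⟩ := cut_le hG (2 * i) (2 * i + 1) (2 * i + 1) (2 * i + 2) le_rfl (by omega) (by omega) (by omega) (by omega)
  obtain ⟨u2, w2, b1, b2, b3, b4, b5⟩ := cut_le hG (2 * i + 1) (2 * i + 1) (2 * i) (2 * i + 2) (by omega) (by omega) (by omega) (by omega) (by omega)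
  have ca := hcross u1 w1 a1 a2 a3
  have cb := hcross u2 w2 b1 b2 b3
  have e1 : u1 = 2 * i + 1 := by omega
  have e2 : u2 = 2 * i := by omega
  subst e1 e2
  have hww : w1 ≠ w2 := by
    intro hw
    subst hw
    obtain ⟨u3, w3, c1, c2, c3, c4, c5⟩ := cut_le hG w1 (2 * i + 1) (2 * i) (if w1 = 2 * i + 2 then 2 * i + 3 else 2 * i + 2)
      (by omega) (by omega) (by split_ifs <;> omega) (by split_ifs <;> omega) (by split_ifs <;> omega)
    exact h3 _ _ _ _ _ _ a1 b1 c1 a2 a3 b2 b3 c2 c3 (by omega) (by omega) (by omega)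
  have hall : ∀ u w, A u w → u ≤ 2 * i + 1 → 2 * i + 1 < w → (u = 2 * i + 1 ∧ w = w1) ∨ (u = 2 * i ∧ w = w2) := by
    intro u w h g1 g2
    by_contra hc
    exact h3 _ _ _ _ _ _ a1 b1 h a2 a3 b2 b3 g1 g2 (by omega) (by omega) (by omega)
  refine ⟨decide (w2 = 2 * i + 3), fun s t => ⟨fun h => ?_, fun h => ?_⟩⟩
  · have hb : ∀ s, bit s ≤ 1 := fun s => by cases s <;> simp [bit]
    have := hall _ _ h (by have := hb s; omega) (by omega)
    cases s <;> cases t <;> simp [bit] at this ⊢ <;> omega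
  · cases s <;> cases t <;> simp [bit] at h ⊢
    · rwa [show 2 * (i + 1) = w2 by omega]
    · rwa [show 2 * (i + 1) + 1 = w2 by omega]
    · rwa [show 2 * (i + 1) = w1 by omega]
    · rwa [show 2 * (i + 1) + 1 = w1 by omega]

lemma structure_lemma {q : ℕ} {A : ℕ → ℕ → Prop} (hG : OGraph (2 * q + 4) A) (sg : ℕ → Bool)
    (hcc : ∀ i j, i ≤ q + 1 → j ≤ q + 1 →
      cc (2 * q + 4) A sg (2 * i) (2 * j) = bm (dB q) (oB q) (eB q) (2 * i) (2 * j)) :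
    (∀ u w, A u w → w / 2 ≤ u / 2 + 1) ∧
    A 0 1 ∧ (∀ i, 1 ≤ i → i ≤ q + 1 → ¬ A (2 * i) (2 * i + 1)) ∧
    (∀ i, i < q → ∃ w : Bool, ∀ s t, A (2 * i + bit s) (2 * (i + 1) + bit t) ↔ xor s t = w) ∧
    (∀ s t, A (2 * q + bit s) (2 * (q + 1) + bit t)) := by
  have hoff : ∀ i j, i ≤ q + 1 → j ≤ q + 1 → i ≠ j → cc (2 * q + 4) A sg (2 * i) (2 * j) = 0 := by
    intro i j hi hj hij
    rw [hcc i j hi hj]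
    unfold bm eB
    rw [if_neg (by omega), if_neg (by omega), if_neg (by omega)]
    split_ifs <;> omega
  have hdiag : ∀ i, 1 ≤ i → i ≤ q → cc (2 * q + 4) A sg (2 * i) (2 * i) = 2 := by
    intro i hi hj
    rw [hcc i i (by omega) (by omega)]
    unfold bm dB d0
    rw [if_pos rfl, if_neg (by omega), if_neg (by omega), if_neg (by omega)]
  have hsign := sign_odd hG sg (hoff 0 1 (by omega) (by omega) (by omega))
  have hlev : ∀ u w, A u w → u < w → w / 2 ≤ u / 2 + 1 := by
    intro u w h huw
    by_contra hc
    have hl := hG.lt _ _ h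
    have h1 := cc_ge1 (sg := sg) hG huw h (2 * (u / 2 + 1)) (2 * (u / 2 + 2))
    rw [hoff _ _ (by omega) (by omega) (by omega), gv_pass (by omega) (by omega), gv_pass (by omega) (by omega)] at h1
    omega
  obtain ⟨u, w, huw, hs⟩ := hG.nonbip sg
  have h01 : A 0 1 ∧ sg 0 = sg 1 := by
    rcases hsign u w huw hs with ⟨rfl, rfl⟩ | ⟨rfl, rfl⟩
    · exact ⟨huw, hs⟩
    · exact ⟨hG.symm _ _ huw, hs.symm⟩
  have hmat : ∀ i, i < q → ∃ w : Bool, ∀ s t, A (2 * i + bit s) (2 * (i + 1) + bit t) ↔ xor s t = w := by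
    intro i hi
    exact gap_match hG sg i (by omega) hlev (hdiag (i + 1) (by omega) (by omega))
  have hsg : ∀ i, i ≤ q → sg (2 * i) = sg (2 * i + 1) := by
    intro i
    induction i with
    | zero => intro _; exact h01.2
    | succ i ih =>
      intro hi
      have h := ih (by omega)
      obtain ⟨w, hw⟩ := hmat i (by omega)
      have m1 := (hw false w).2 (by simp)
      have m2 := (hw true (!w)).2 (by simp)
      have n1 : sg (2 * i + bit false) ≠ sg (2 * (i + 1) + bit w) := fun hh => by
        have := hsign _ _ m1 hh; omega
      have n2 : sg (2 * i + bit true) ≠ sg (2 * (i + 1) + bit (!w)) := fun hh => by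
        have := hsign _ _ m2 hh; omega
      simp only [bit] at n1 n2
      rw [show (if false = true then 1 else 0) = 0 from rfl, Nat.add_zero, h] at n1
      have n3 := bool_ne_ne n1 n2
      cases w <;> simp at n3
      · exact n3
      · exact n3.symm
  have htn : ∀ v x, (v = 2 * q + 2 ∨ v = 2 * q + 3) → A v x → x = 2 * q ∨ x = 2 * q + 1 ∨ x = 2 * q + 2 ∨ x = 2 * q + 3 := by
    intro v x hv h
    have hl := hG.lt _ _ h
    rcases lt_or_gt_of_ne (hG.ne _ _ h) with g | g
    · omega
    · have := hlev x v (hG.symm _ _ h) g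
      omega
  have hlow : ∀ v v', (v = 2 * q + 2 ∧ v' = 2 * q + 3 ∨ v = 2 * q + 3 ∧ v' = 2 * q + 2) →
      sg (2 * q) ≠ sg v := by
    intro v v' hv
    obtain ⟨z, hz, hzv⟩ := cut_single hG (v := v') (r := v) (by omega) (by omega)
    have h1 := htn v z (by omega) hz
    have h2 := hG.ne _ _ hz
    have h3 : z = 2 * q ∨ z = 2 * q + 1 := by omega
    have h4 : sg v ≠ sg z := fun hh => by
      have := hsign _ _ hz hh; omega
    rcases h3 with rfl | rfl
    · exact h4.symm
    · rw [hsg q le_rfl]; exact h4.symm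
  have hsgt : sg (2 * q + 2) = sg (2 * q + 3) :=
    bool_ne_ne (hlow (2 * q + 2) (2 * q + 3) (by omega)) (hlow (2 * q + 3) (2 * q + 2) (by omega))
  have hno : ¬ A (2 * q + 2) (2 * q + 3) := fun h => by
    have := hsign _ _ h hsgt; omega
  have hfull : ∀ v x, (v = 2 * q + 2 ∨ v = 2 * q + 3) → (x = 2 * q ∨ x = 2 * q + 1) → A x v := by
    intro v x hv hx
    obtain ⟨z, hz, hzv⟩ := cut_single hG (v := 4 * q + 1 - x) (r := v) (by omega) (by omega)
    have h1 := htn v z hv hz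
    have h2 := hG.ne _ _ hz
    have h3 : ¬ (z = 2 * q + 2 ∨ z = 2 * q + 3) := by
      intro hc
      rcases hv with rfl | rfl
      · have : z = 2 * q + 3 := by omega
        subst this; exact hno hz
      · have : z = 2 * q + 2 := by omega
        subst this; exact hno (hG.symm _ _ hz)
    have : z = x := by omega
    subst this
    exact hG.symm _ _ hz
  refine ⟨?_, h01.1, ?_, hmat, ?_⟩
  · intro u w h
    rcases lt_or_gt_of_ne (hG.ne _ _ h) with g | g
    · exact hlev u w h g
    · omega
  · intro i hi hiq h
    rcases Nat.lt_or_ge q i with h' | h'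
    · have : i = q + 1 := by omega
      subst this
      exact hno h
    · have := hsign _ _ h (hsg i h')
      omega
  · intro s t
    apply hfull <;> cases s <;> cases t <;> simp [bit] <;> omega

/-- Level of a vertex of the theta graph. -/
def lev (q k : ℕ) : ℕ := if k = 0 then q + 1 else if k ≤ q + 2 then q + 2 - k else k - (q + 3)
/-- Side of a vertex of the theta graph. -/
def side (q k : ℕ) : Bool := decide (k = 0 ∨ q + 2 < k)

lemma theta_adj (q k l : ℕ) (hk : k < 2 * q + 4) (hl : l < 2 * q + 4) :
    (thetaG (2 * q + 4)).Adj ⟨k, hk⟩ ⟨l, hl⟩ ↔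
      ((lev q k = lev q l ∧ side q k ≠ side q l ∧ lev q k = 0) ∨
       (lev q l = lev q k + 1 ∧ (side q k = side q l ∨ lev q k = q)) ∨
       (lev q k = lev q l + 1 ∧ (side q k = side q l ∨ lev q l = q))) := by
  unfold thetaG thetaJK
  rw [SimpleGraph.fromRel_adj]
  have hk' : (k = 0 ∧ lev q k = q + 1 ∧ side q k = true) ∨ (1 ≤ k ∧ lev q k + k = q + 2 ∧ side q k = false) ∨
      (q + 2 < k ∧ k = lev q k + (q + 3) ∧ side q k = true) := by
    unfold lev side; simp only [decide_eq_true_eq, decide_eq_false_iff_not]; split_ifs <;> omega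
  have hl' : (l = 0 ∧ lev q l = q + 1 ∧ side q l = true) ∨ (1 ≤ l ∧ lev q l + l = q + 2 ∧ side q l = false) ∨
      (q + 2 < l ∧ l = lev q l + (q + 3) ∧ side q l = true) := by
    unfold lev side; simp only [decide_eq_true_eq, decide_eq_false_iff_not]; split_ifs <;> omega
  simp only [ne_eq, Fin.mk.injEq]
  generalize lev q k = i at *
  generalize lev q l = j at *
  rcases hk' with ⟨c1, c2, c3⟩ | ⟨c1, c2, c3⟩ | ⟨c1, c2, c3⟩ <;>
  rcases hl' with ⟨d1, d2, d3⟩ | ⟨d1, d2, d3⟩ | ⟨d1, d2, d3⟩ <;>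
  rw [c3, d3] <;> simp only [not_true, false_and, and_false, true_or, and_true, true_and, false_or, reduceCtorEq, not_false_eq_true] <;>
  constructor <;> intro h <;> omega

lemma iso_core {q : ℕ} {A : ℕ → ℕ → Prop} (hG : OGraph (2 * q + 4) A) (sg : ℕ → Bool)
    (hcc : ∀ i j, i ≤ q + 1 → j ≤ q + 1 →
      cc (2 * q + 4) A sg (2 * i) (2 * j) = bm (dB q) (oB q) (eB q) (2 * i) (2 * j)) :
    ∃ f : ℕ → ℕ, (∀ k, k < 2 * q + 4 → f k < 2 * q + 4) ∧
      (∀ k l, k < 2 * q + 4 → l < 2 * q + 4 → f k = f l → k = l) ∧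
      ∀ k l (hk : k < 2 * q + 4) (hl : l < 2 * q + 4),
        A (f k) (f l) ↔ (thetaG (2 * q + 4)).Adj ⟨k, hk⟩ ⟨l, hl⟩ := by
  obtain ⟨h1, h2, h3, h4, h5⟩ := structure_lemma hG sg hcc
  have h4' : ∀ i, ∃ w : Bool, i < q → ∀ s t, A (2 * i + bit s) (2 * (i + 1) + bit t) ↔ xor s t = w := by
    intro i
    by_cases h : i < q
    · obtain ⟨w, hw⟩ := h4 i h
      exact ⟨w, fun _ => hw⟩
    · exact ⟨true, fun h' => absurd h' h⟩
  choose w hw using h4'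
  let x : ℕ → Bool := fun i => Nat.rec false (fun i y => xor y (w i)) i
  have hx : ∀ i, x (i + 1) = xor (x i) (w i) := fun i => rfl
  have hbit : ∀ s, bit s ≤ 1 := fun s => by cases s <;> simp [bit]
  have bit_inj : ∀ s t, bit s = bit t → s = t := fun s t => by cases s <;> cases t <;> simp [bit]
  let P : ℕ → Bool → ℕ := fun i s => 2 * i + bit (xor s (x i))
  have hlevb : ∀ k, k < 2 * q + 4 → lev q k ≤ q + 1 := by
    intro k hk; unfold lev; split_ifs <;> omega
  have up : ∀ i s t, i ≤ q → (A (P i s) (P (i + 1) t) ↔ (s = t ∨ i = q)) := by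
    intro i s t hi
    rcases Nat.lt_or_ge i q with h | h
    · have := hw i h (xor s (x i)) (xor t (x (i + 1)))
      refine this.trans ?_
      rw [hx]
      cases s <;> cases t <;> cases x i <;> cases w i <;> simp <;> omega
    · have : i = q := by omega
      subst this
      simp only [or_true, iff_true]
      exact h5 _ _
  have dn : ∀ i s t, i ≤ q → (A (P (i + 1) t) (P i s) ↔ (s = t ∨ i = q)) := fun i s t hi =>
    ⟨fun h => (up i s t hi).1 (hG.symm _ _ h), fun h => hG.symm _ _ ((up i s t hi).2 h)⟩
  have same : ∀ i s t, i ≤ q + 1 → (A (P i s) (P i t) ↔ (s ≠ t ∧ i = 0)) := by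
    intro i s t hi
    constructor
    · intro h
      have hst : s ≠ t := fun hh => hG.ne _ _ h (by rw [hh])
      refine ⟨hst, ?_⟩
      by_contra hc
      have h3' := h3 i (by omega) hi
      have hP : (P i s = 2 * i ∧ P i t = 2 * i + 1) ∨ (P i s = 2 * i + 1 ∧ P i t = 2 * i) := by
        show (2 * i + bit (xor s (x i)) = _ ∧ 2 * i + bit (xor t (x i)) = _) ∨ (2 * i + bit (xor s (x i)) = _ ∧ 2 * i + bit (xor t (x i)) = _)
        cases s <;> cases t <;> cases x i <;> simp [bit] at hst ⊢
      rcases hP with ⟨e1, e2⟩ | ⟨e1, e2⟩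
      · rw [e1, e2] at h; exact h3' h
      · rw [e1, e2] at h; exact h3' (hG.symm _ _ h)
    · rintro ⟨hst, rfl⟩
      have hx0 : x 0 = false := rfl
      have h2' := hG.symm _ _ h2
      show A (2 * 0 + bit (xor s (x 0))) (2 * 0 + bit (xor t (x 0)))
      rw [hx0]
      cases s <;> cases t <;> simp [bit] at hst ⊢ <;> assumption
  have hdiv : ∀ i s, P i s / 2 = i := by
    intro i s
    show (2 * i + bit _) / 2 = i
    have := hbit (xor s (x i)); omega
  refine ⟨fun k => P (lev q k) (side q k), ?_, ?_, ?_⟩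
  · intro k hk
    have := hlevb k hk
    have := hbit (xor (side q k) (x (lev q k)))
    show 2 * _ + bit _ < _
    omega
  · intro k l hk hl h
    have h' : P (lev q k) (side q k) = P (lev q l) (side q l) := h
    have e1 : lev q k = lev q l := by rw [← hdiv (lev q k) (side q k), h', hdiv]
    have e2 : side q k = side q l := by
      rw [e1] at h'
      have h'' : 2 * lev q l + bit (xor (side q k) (x (lev q l))) = 2 * lev q l + bit (xor (side q l) (x (lev q l))) := h'
      have := bit_inj _ _ (Nat.add_left_cancel h'')
      revert this
      cases side q k <;> cases side q l <;> cases x (lev q l) <;> simp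
    unfold side at e2
    rw [decide_eq_decide] at e2
    unfold lev at e1
    split_ifs at e1 <;> omega
  · intro k l hk hl
    rw [theta_adj]
    have b1 := hlevb k hk
    have b2 := hlevb l hl
    show A (P (lev q k) (side q k)) (P (lev q l) (side q l)) ↔ _
    generalize lev q k = i at *
    generalize lev q l = j at *
    generalize side q k = s at *
    generalize side q l = t at *
    by_cases c1 : i = j
    · subst c1
      rw [same i s t b1]
      constructor
      · intro h; left; exact ⟨rfl, h⟩
      · rintro (h | h | h)
        · exact h.2
        · omega
        · omega
    by_cases c2 : j = i + 1
    · subst c2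
      rw [up i s t (by omega)]
      constructor
      · intro h; right; left; exact ⟨rfl, h⟩
      · rintro (h | h | h)
        · omega
        · exact h.2
        · omega
    by_cases c3 : i = j + 1
    · subst c3
      rw [dn j t s (by omega)]
      constructor
      · intro h; right; right; exact ⟨rfl, h.imp_left Eq.symm⟩
      · rintro (h | h | h)
        · omega
        · omega
        · exact h.2.imp_left Eq.symm
    · constructor
      · intro h
        have g1 := h1 _ _ h
        have g2 := h1 _ _ (hG.symm _ _ h)
        rw [hdiv, hdiv] at g1 g2
        omega
      · rintro (h | h | h) <;> omega


section
variable {V : Type*} [Fintype V]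

lemma mkO {n : ℕ} (hn : 4 ≤ n) (heven : Even n) (G : SimpleGraph V) (e : Fin n ≃ V) (v : ℕ → V)
    (hv : ∀ i (h : i < n), v i = e ⟨i, h⟩) (h2 : TwoConnected G) (hnb : ¬ G.Colorable 2) :
    OGraph n (fun p r => p < n ∧ r < n ∧ G.Adj (v p) (v r)) := by
  have hid : ∀ z, v (e.symm z).val = z := fun z => by
    rw [hv _ (e.symm z).isLt]; simp
  have hinj : ∀ i j, i < n → j < n → v i = v j → i = j := by
    intro i j hi hj h
    rw [hv i hi, hv j hj] at h
    have := e.injective h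
    simpa using this
  refine ⟨hn, heven, fun p r h => ⟨h.1, h.2.1⟩, fun p r h hpr => ?_, fun p r h => ⟨h.2.1, h.1, h.2.2.symm⟩, ?_, ?_⟩
  · rw [hpr] at h; exact G.loopless.irrefl _ h.2.2
  · rintro c S ⟨s, hs, hsS, hsc⟩ ⟨t, ht, htS, htc⟩
    obtain ⟨d, hd, hds, hdt, hdc⟩ : ∃ d, d < n ∧ d ≠ s ∧ d ≠ t ∧ (c < n → d = c) := by
      by_cases hc : c < n
      · exact ⟨c, hc, hsc.symm, htc.symm, fun _ => rfl⟩
      by_cases k0 : 0 ≠ s ∧ 0 ≠ t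
      · exact ⟨0, by omega, k0.1, k0.2, fun h => absurd h hc⟩
      by_cases k1 : 1 ≠ s ∧ 1 ≠ t
      · exact ⟨1, by omega, k1.1, k1.2, fun h => absurd h hc⟩
      exact ⟨2, by omega, by omega, by omega, fun h => absurd h hc⟩
    have hconn := h2.2 (v d)
    have ms : v s ∈ ((⊤ : G.Subgraph).deleteVerts {v d}).verts := by
      rw [Subgraph.deleteVerts_verts]
      exact ⟨trivial, fun h => hds (hinj _ _ hs hd h).symm⟩
    have mt : v t ∈ ((⊤ : G.Subgraph).deleteVerts {v d}).verts := by
      rw [Subgraph.deleteVerts_verts]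
      exact ⟨trivial, fun h => hdt (hinj _ _ ht hd h).symm⟩
    obtain ⟨p⟩ := hconn.preconnected ⟨v s, ms⟩ ⟨v t, mt⟩
    have hev : ∀ i, i < n → (e.symm (v i)).val = i := by
      intro i hi; rw [hv i hi]; simp
    obtain ⟨f, _, hf1, hf2⟩ := p.exists_boundary_dart {z | S (e.symm z.1).val}
      (by simp only [Set.mem_ofPred_eq, hev s hs]; exact hsS) (by simp only [Set.mem_ofPred_eq, hev t ht]; exact htS)
    have hadj := f.adj
    rw [Subgraph.coe_adj, Subgraph.deleteVerts_adj] at hadj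
    obtain ⟨_, n1, _, n2, hA⟩ := hadj
    have hA' : G.Adj f.fst.1 f.snd.1 := hA.adj_sub
    refine ⟨(e.symm f.fst.1).val, (e.symm f.snd.1).val, ⟨(e.symm f.fst.1).isLt, (e.symm f.snd.1).isLt, ?_⟩, hf1, hf2, ?_, ?_⟩
    · rw [hid, hid]; exact hA'
    · intro h
      have hc : c < n := h ▸ (e.symm f.fst.1).isLt
      apply n1
      rw [Set.mem_singleton_iff]
      exact (hid f.fst.1).symm.trans (congrArg v (h.trans (hdc hc).symm))
    · intro h
      have hc : c < n := h ▸ (e.symm f.snd.1).isLt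
      apply n2
      rw [Set.mem_singleton_iff]
      exact (hid f.snd.1).symm.trans (congrArg v (h.trans (hdc hc).symm))
  · intro sg
    by_contra hc
    apply hnb
    have C : G.Coloring Bool := Coloring.mk (fun z => sg (e.symm z).val) (fun {z w} hzw hh => hc
      ⟨(e.symm z).val, (e.symm w).val, ⟨(e.symm z).isLt, (e.symm w).isLt, by rw [hid, hid]; exact hzw⟩, hh⟩)
    simpa using C.colorable

lemma sumV {n : ℕ} (e : Fin n ≃ V) (v : ℕ → V) (hv : ∀ i (h : i < n), v i = e ⟨i, h⟩) (f : V → ℝ) :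
    ∑ z, f z = ∑ i ∈ Finset.range n, f (v i) := by
  rw [← Equiv.sum_comp e, ← Fin.sum_univ_eq_sum_range (fun i => f (v i))]
  refine Finset.sum_congr rfl fun i _ => ?_
  rw [hv i.val i.isLt]

lemma FF_qf {n : ℕ} (G : SimpleGraph V) (e : Fin n ≃ V) (v : ℕ → V)
    (hv : ∀ i (h : i < n), v i = e ⟨i, h⟩) (x : V → ℝ) :
    2 * FF n (fun p r => p < n ∧ r < n ∧ G.Adj (v p) (v r)) (fun p => decide (0 ≤ x (v p))) (fun p => |x (v p)|) = qf G x := by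
  unfold qf FF
  rw [sumV e v hv]
  simp only [sumV e v hv]
  rw [Finset.sum_product]
  let h : ℕ → ℕ → ℝ := fun p r => if p < r then (if G.Adj (v p) (v r) then (x (v p) + x (v r)) ^ 2 else 0) else 0
  have h1 : ∀ p ∈ Finset.range n, ∀ r ∈ Finset.range n,
      (if p < r ∧ (p < n ∧ r < n ∧ G.Adj (v p) (v r)) then
        (if decide (0 ≤ x (v p)) = decide (0 ≤ x (v r)) then |x (v p)| + |x (v r)| else |x (v r)| - |x (v p)|) ^ 2 else 0) = h p r := by
    intro p hp r hr
    rw [Finset.mem_range] at hp hr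
    simp only [h, hp, hr, true_and]
    by_cases c : p < r
    · by_cases c' : G.Adj (v p) (v r)
      · simp only [c, c', and_true, if_true, decide_eq_decide]
        rcases le_or_gt 0 (x (v p)) with g | g <;> rcases le_or_gt 0 (x (v r)) with g' | g'
        · simp only [g, g', if_true, abs_of_nonneg]
        · simp only [g, not_le.2 g', iff_false, not_true, if_false, abs_of_nonneg g, abs_of_neg g']; ring
        · simp only [g', not_le.2 g, false_iff, not_true, if_false, abs_of_nonneg g', abs_of_neg g]; ring
        · simp only [not_le.2 g, not_le.2 g', if_true, abs_of_neg g, abs_of_neg g']; ring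
      · simp [c']
    · simp [c]
  have h2 : ∀ p ∈ Finset.range n, ∀ r ∈ Finset.range n,
      (if G.Adj (v p) (v r) then (x (v p) + x (v r)) ^ 2 else 0) = h p r + h r p := by
    intro p hp r hr
    simp only [h]
    rcases lt_trichotomy p r with c | c | c
    · simp [c, not_lt.2 c.le]
    · subst c; simp
    · simp only [c, not_lt.2 c.le, if_true, if_false, zero_add, G.adj_comm (v p)]
      rw [add_comm (x (v p))]
  rw [Finset.sum_congr rfl fun p hp => Finset.sum_congr rfl (h1 p hp),
    Finset.sum_congr rfl fun p hp => Finset.sum_congr rfl (h2 p hp)]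
  simp only [Finset.sum_add_distrib]
  rw [Finset.sum_comm (f := fun p r => h r p)]
  ring

lemma top_ineq {m : ℕ} (G : SimpleGraph V) (e : Fin (m + 3) ≃ V) (v : ℕ → V)
    (hv : ∀ i (h : i < m + 3), v i = e ⟨i, h⟩) (x : V → ℝ) (μ : ℝ)
    (hx : (signlessLaplacian G).mulVec x = μ • x)
    (hO : OGraph (m + 3) (fun p r => p < m + 3 ∧ r < m + 3 ∧ G.Adj (v p) (v r)))
    (hmono : ∀ i j, i ≤ j → j < m + 3 → |x (v i)| ≤ |x (v j)|) (htop : 0 < |x (v (m + 2))|) :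
    (|x (v (m + 2))| - |x (v (m + 1))|) + (|x (v (m + 2))| - |x (v m)|) ≤ μ * |x (v (m + 2))| := by
  have h := congrFun hx (v (m + 2))
  rw [mulVec_eq, sumV e v hv] at h
  simp only [Pi.smul_apply, smul_eq_mul] at h
  set M := |x (v (m + 2))| with hM
  obtain ⟨z, hz, hz1⟩ := cut_single hO (v := m + 3) (r := m + 2) (by omega) (by omega)
  obtain ⟨y, hy, hy1⟩ := cut_single hO (v := z) (r := m + 2) (by omega) (by have := hO.ne _ _ hz; omega)
  have nz := hO.ne _ _ hz
  have ny := hO.ne _ _ hy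
  let g : ℕ → ℝ := fun i => x (v (m + 2)) * (if G.Adj (v (m + 2)) (v i) then (x (v (m + 2)) + x (v i)) else 0)
  have hg : ∑ i ∈ Finset.range (m + 3), g i = μ * M * M := by
    rw [← Finset.mul_sum, h, mul_assoc, hM, abs_mul_abs_self]; ring
  have key : ∀ i, i < m + 3 → M * (M - |x (v i)|) ≤ x (v (m + 2)) * (x (v (m + 2)) + x (v i)) := by
    intro i hi
    have e1 : M * M = x (v (m + 2)) * x (v (m + 2)) := abs_mul_abs_self _
    have e2 : M * |x (v i)| = |x (v (m + 2)) * x (v i)| := (abs_mul _ _).symm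
    have e3 := neg_abs_le (x (v (m + 2)) * x (v i))
    nlinarith
  have gnn : ∀ i ∈ Finset.range (m + 3), 0 ≤ g i := by
    intro i hi
    rw [Finset.mem_range] at hi
    simp only [g]
    split_ifs
    · refine le_trans (mul_nonneg htop.le ?_) (key i hi)
      have := hmono i (m + 2) (by omega) (by omega)
      linarith
    · simp
  have hpair : g z + g y ≤ ∑ i ∈ Finset.range (m + 3), g i := by
    rw [← Finset.sum_pair (Ne.symm hy1)]
    refine Finset.sum_le_sum_of_subset_of_nonneg ?_ fun i hi _ => gnn i hi
    intro i hi
    simp only [Finset.mem_insert, Finset.mem_singleton] at hi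
    rw [Finset.mem_range]
    rcases hi with rfl | rfl
    · exact hz.2.1
    · exact hy.2.1
  have gz : M * (M - |x (v z)|) ≤ g z := by
    simp only [g, hz.2.2, if_true]; exact key z hz.2.1
  have gy : M * (M - |x (v y)|) ≤ g y := by
    simp only [g, hy.2.2, if_true]; exact key y hy.2.1
  have hzlt := hz.2.1
  have hylt := hy.2.1
  have hsum : |x (v z)| + |x (v y)| ≤ |x (v (m + 1))| + |x (v m)| := by
    rcases Nat.lt_or_ge z (m + 1) with c | c
    · have := hmono z m (by omega) (by omega)
      have := hmono y (m + 1) (by omega) (by omega)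
      linarith
    · have := hmono z (m + 1) (by omega) (by omega)
      have := hmono y m (by omega) (by omega)
      linarith
  have hfin : M * ((M - |x (v (m + 1))|) + (M - |x (v m)|)) ≤ M * (μ * M) := by nlinarith
  exact le_of_mul_le_mul_left hfin htop

end

theorem stmt10 (n : ℕ) (hn : 4 ≤ n) (heven : Even n) {V : Type*} [Fintype V]
    (G : SimpleGraph V) (hcard : Fintype.card V = n)
    (h2 : TwoConnected G) (hnb : ¬ G.Colorable 2) :
    leastQEig (thetaG n) ≤ leastQEig G ∧
      (leastQEig (thetaG n) = leastQEig G ↔ Nonempty (G ≃g thetaG n)) := by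
  obtain ⟨q, rfl⟩ : ∃ q, n = 2 * q + 4 := by
    obtain ⟨k, hk⟩ := heven
    exact ⟨k - 2, by omega⟩
  haveI : Nonempty V := Fintype.card_pos_iff.1 (by omega)
  obtain ⟨⟨x, hx0, hx⟩, _⟩ := least_spec G
  have hT : TestIneq q (leastQEig (thetaG (2 * q + 4))) := fun L R u t => theta_test q L R u t
  let e0 := Fintype.equivFinOfCardEq hcard
  let g : Fin (2 * q + 4) → ℝ := fun i => |x (e0.symm i)|
  let e : Fin (2 * q + 4) ≃ V := (Tuple.sort g).trans e0.symm
  have hsort : Monotone (fun i => |x (e i)|) := Tuple.monotone_sort g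
  obtain ⟨v, hv⟩ : ∃ v : ℕ → V, ∀ i (h : i < 2 * q + 4), v i = e ⟨i, h⟩ :=
    ⟨fun i => if h : i < 2 * q + 4 then e ⟨i, h⟩ else Classical.arbitrary V, fun i h => dif_pos h⟩
  have hO := mkO hn heven G e v hv h2 hnb
  have hmono : ∀ i j, i ≤ j → j < 2 * q + 4 → |x (v i)| ≤ |x (v j)| := by
    intro i j hij hj
    rw [hv i (by omega), hv j hj]
    exact hsort (by simpa using hij)
  have htop : 0 < |x (v (2 * q + 3))| := by
    by_contra hc
    push Not at hc
    apply hx0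
    funext z
    have h1 := hmono (e.symm z).val (2 * q + 3) (by have := (e.symm z).isLt; omega) (by omega)
    rw [hv _ (e.symm z).isLt] at h1
    simp only [Fin.eta, Equiv.apply_symm_apply] at h1
    exact abs_nonpos_iff.1 (h1.trans hc)
  have hFF : FF (2 * q + 4) (fun p r => p < 2 * q + 4 ∧ r < 2 * q + 4 ∧ G.Adj (v p) (v r))
      (fun p => decide (0 ≤ x (v p))) (fun p => |x (v p)|)
      ≤ leastQEig G * ∑ i ∈ Finset.range (2 * q + 4), |x (v i)| ^ 2 := by
    have h1 := FF_qf G e v hv x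
    rw [qf_eigen G x _ hx, sumV e v hv] at h1
    simp only [sq_abs]
    linarith
  have hnn : ∀ i, i < 2 * q + 4 → 0 ≤ inc (fun p => |x (v p)|) i := by
    intro i hi
    rcases i with _ | i
    · simp [inc]
    · rw [inc_succ]
      exact sub_nonneg.2 (hmono i (i + 1) (by omega) hi)
  have hev := top_ineq (m := 2 * q + 1) G e v hv x _ hx hO hmono htop
  obtain ⟨r1, r2⟩ := analytic hO (fun p => decide (0 ≤ x (v p))) (fun p => |x (v p)|) _ _ hnn htop hFF hT hev
  refine ⟨r1, fun heq => ?_, fun ⟨f⟩ => (least_iso G _ f).symm⟩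
  obtain ⟨f, f1, f2, f3⟩ := iso_core hO _ (r2 heq)
  let F : Fin (2 * q + 4) → Fin (2 * q + 4) := fun k => ⟨f k.val, f1 k.val k.isLt⟩
  have hF : Function.Injective F := by
    intro k l h
    exact Fin.ext (f2 _ _ k.isLt l.isLt (by simpa [F] using h))
  let E : Fin (2 * q + 4) ≃ Fin (2 * q + 4) := Equiv.ofBijective F (Finite.injective_iff_bijective.1 hF)
  refine ⟨(RelIso.symm ⟨E.trans e, ?_⟩)⟩
  intro k l
  have h := f3 k.val l.val k.isLt l.isLt
  rw [hv _ (f1 _ k.isLt), hv _ (f1 _ l.isLt)] at h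
  have hk := f1 _ k.isLt
  have hl := f1 _ l.isLt
  simp only [hk, hl, true_and] at h
  exact h
end

section
/- Let n ≥ 4 be even, G a nonbipartite 2-connected graph of order n, X a least-eigenvalue eigenvector of Q(G), v_μ a vertex with |x(v_μ)| maximal lying on an odd cycle C of G. If n − L(C) ≥ 3, then q(Θ) < q(G). -/
open Matrix SimpleGraph
open scoped Classical

namespace Stmt11Aux

/-- Twice the signless Dirichlet energy. -/
noncomputable def energy {V : Type*} [Fintype V] (G : SimpleGraph V) (y : V → ℝ) : ℝ :=
  ∑ i, ∑ j, if G.Adj i j then (y i + y j) ^ 2 else 0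

theorem energy_nonneg {V : Type*} [Fintype V] (G : SimpleGraph V) (y : V → ℝ) :
    0 ≤ energy G y := by
  unfold energy
  refine Finset.sum_nonneg fun i _ => Finset.sum_nonneg fun j _ => ?_
  split_ifs <;> positivity

theorem mulVec_apply {V : Type*} [Fintype V] (G : SimpleGraph V) (y : V → ℝ) (i : V) :
    (signlessLaplacian G).mulVec y i = ∑ j, if G.Adj i j then (y i + y j) else 0 := by
  have hdeg : ((G.neighborSet i).ncard : ℝ) = ∑ j, if G.Adj i j then (1 : ℝ) else 0 := by
    rw [Finset.sum_boole]
    congr 1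
    rw [Set.ncard_eq_toFinset_card']
    congr 1
    ext j
    simp
  simp only [Matrix.mulVec, dotProduct, signlessLaplacian, add_mul, Finset.sum_add_distrib,
    ite_mul, zero_mul, one_mul, Finset.sum_ite_eq, Finset.mem_univ, if_true]
  rw [hdeg, Finset.sum_mul, ← Finset.sum_add_distrib]
  refine Finset.sum_congr rfl fun j _ => ?_
  split_ifs <;> ring

theorem dot_mulVec {V : Type*} [Fintype V] (G : SimpleGraph V) (y : V → ℝ) :
    2 * (y ⬝ᵥ (signlessLaplacian G).mulVec y) = energy G y := by
  have h1 : y ⬝ᵥ (signlessLaplacian G).mulVec y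
      = ∑ i, ∑ j, if G.Adj i j then y i * (y i + y j) else 0 := by
    simp only [dotProduct, mulVec_apply, Finset.mul_sum, mul_ite, mul_zero]
  have h2 : y ⬝ᵥ (signlessLaplacian G).mulVec y
      = ∑ i, ∑ j, if G.Adj i j then y j * (y i + y j) else 0 := by
    rw [h1, Finset.sum_comm]
    refine Finset.sum_congr rfl fun i _ => Finset.sum_congr rfl fun j _ => ?_
    simp only [G.adj_comm i j, add_comm (y i) (y j)]
  rw [two_mul]
  nth_rewrite 1 [h1]
  rw [h2, energy, ← Finset.sum_add_distrib]
  refine Finset.sum_congr rfl fun i _ => ?_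
  rw [← Finset.sum_add_distrib]
  refine Finset.sum_congr rfl fun j _ => ?_
  split_ifs <;> ring

theorem isHermitian {V : Type*} [Fintype V] (G : SimpleGraph V) :
    (signlessLaplacian G).IsHermitian := by
  ext i j
  simp only [conjTranspose_apply, signlessLaplacian, star_trivial, G.adj_comm i j]
  by_cases h : i = j
  · subst h; rfl
  · simp [h, Ne.symm h]

theorem dot_self_pos {V : Type*} [Fintype V] (y : V → ℝ) (hy : y ≠ 0) : 0 < y ⬝ᵥ y := by
  rcases (show 0 ≤ y ⬝ᵥ y from Finset.sum_nonneg fun i _ => mul_self_nonneg _).lt_or_eq with h | h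
  · exact h
  · exact absurd (dotProduct_self_eq_zero.1 h.symm) hy

theorem eig_nonneg {V : Type*} [Fintype V] (G : SimpleGraph V) (y : V → ℝ) (hy : y ≠ 0) (μ : ℝ)
    (h : (signlessLaplacian G).mulVec y = μ • y) : 0 ≤ μ := by
  have h1 := dot_mulVec G y
  rw [h, dotProduct_smul, smul_eq_mul] at h1
  have h2 := energy_nonneg G y
  have h3 := dot_self_pos y hy
  by_contra hneg
  push Not at hneg
  nlinarith

theorem posSemidef {V : Type*} [Fintype V] (G : SimpleGraph V) :
    (signlessLaplacian G - leastQEig G • (1 : Matrix V V ℝ)).PosSemidef := by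
  have hH : (signlessLaplacian G - leastQEig G • (1 : Matrix V V ℝ)).IsHermitian := by
    refine (isHermitian G).sub ?_
    rw [Matrix.IsHermitian, conjTranspose_smul, conjTranspose_one, star_trivial]
  rw [hH.posSemidef_iff_eigenvalues_nonneg]
  intro i
  have h := hH.mulVec_eigenvectorBasis i
  set v : V → ℝ := (hH.eigenvectorBasis i).ofLp with hv
  have hv0 : v ≠ 0 := by
    intro h0
    have := hH.eigenvectorBasis.orthonormal.ne_zero i
    apply this
    ext k
    exact congrFun h0 k
  have h3 : (signlessLaplacian G).mulVec v = (hH.eigenvalues i + leastQEig G) • v := by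
    rw [Matrix.sub_mulVec, Matrix.smul_mulVec, Matrix.one_mulVec] at h
    rw [add_smul]
    exact sub_eq_iff_eq_add.1 h
  have h4 : leastQEig G ≤ hH.eigenvalues i + leastQEig G := by
    refine csInf_le ⟨0, ?_⟩ ⟨v, hv0, h3⟩
    rintro μ ⟨w, hw, hw2⟩
    exact eig_nonneg G w hw μ hw2
  simpa using h4

theorem rayleigh {V : Type*} [Fintype V] (G : SimpleGraph V) (y : V → ℝ) :
    2 * leastQEig G * (y ⬝ᵥ y) ≤ energy G y := by
  have h := (posSemidef G).dotProduct_mulVec_nonneg y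
  rw [star_trivial, Matrix.sub_mulVec, Matrix.smul_mulVec, Matrix.one_mulVec, dotProduct_sub,
    dotProduct_smul, smul_eq_mul] at h
  have := dot_mulVec G y
  linarith

theorem rayleigh_eq {V : Type*} [Fintype V] (G : SimpleGraph V) (y : V → ℝ)
    (he : 2 * leastQEig G * (y ⬝ᵥ y) = energy G y) :
    (signlessLaplacian G).mulVec y = leastQEig G • y := by
  have h := (posSemidef G).dotProduct_mulVec_zero_iff y
  rw [star_trivial, Matrix.sub_mulVec, Matrix.smul_mulVec, Matrix.one_mulVec, dotProduct_sub,
    dotProduct_smul, smul_eq_mul] at h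
  have := dot_mulVec G y
  exact sub_eq_zero.1 (h.1 (by linarith))

theorem walk_alt {V : Type*} [Fintype V] (G : SimpleGraph V) (x : V → ℝ)
    (h0 : ∀ i j, G.Adj i j → x i + x j = 0) {a b : V} (c : G.Walk a b) :
    x b = (-1) ^ c.length * x a := by
  induction c with
  | nil => simp
  | cons h p ih =>
    rw [ih, Walk.length_cons, pow_succ]
    have := h0 _ _ h
    rw [eq_neg_of_add_eq_zero_left this]
    ring

theorem energy_zero {V : Type*} [Fintype V] (G : SimpleGraph V) (x : V → ℝ)
    (h : energy G x = 0) (i j : V) (hij : G.Adj i j) : x i + x j = 0 := by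
  unfold energy at h
  have nn : ∀ i j, 0 ≤ if G.Adj i j then (x i + x j) ^ 2 else 0 := by
    intro i j; split_ifs <;> positivity
  rw [Finset.sum_eq_zero_iff_of_nonneg fun i _ => Finset.sum_nonneg fun j _ => nn i j] at h
  have h1 := h i (Finset.mem_univ _)
  rw [Finset.sum_eq_zero_iff_of_nonneg fun j _ => nn i j] at h1
  have h2 := h1 j (Finset.mem_univ _)
  rw [if_pos hij] at h2
  exact pow_eq_zero_iff (two_ne_zero) |>.1 h2

theorem cycle_energy {V : Type*} [Fintype V] (G : SimpleGraph V) (x : V → ℝ) {a : V}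
    (c : G.Walk a a) (hc : c.IsCycle) :
    2 * ∑ i ∈ Finset.range c.length, (x (c.getVert i) + x (c.getVert (i + 1))) ^ 2
      ≤ energy G x := by
  have hL := hc.three_le_length
  have inj1 := hc.getVert_injOn
  have inj0 := hc.getVert_injOn'
  set g := c.getVert with hg
  have key0 : ∀ i j, i < c.length → j < c.length → g i = g j → i = j := by
    intro i j hi hj h
    exact inj0 (show i ≤ c.length - 1 by omega) (show j ≤ c.length - 1 by omega) h
  have key1 : ∀ i j, i < c.length → j < c.length → g (i + 1) = g (j + 1) → i = j := by
    intro i j hi hj h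
    have := inj1 (show 1 ≤ i + 1 ∧ i + 1 ≤ c.length by omega)
      (show 1 ≤ j + 1 ∧ j + 1 ≤ c.length by omega) h
    omega
  have g0L : g c.length = g 0 := by simp [hg]
  have key2 : ∀ i j, i < c.length → j < c.length → g i = g (j + 1) →
      i = j + 1 ∨ (i = 0 ∧ j + 1 = c.length) := by
    intro i j hi hj h
    by_cases hjl : j + 1 = c.length
    · rw [hjl, g0L] at h
      exact Or.inr ⟨key0 _ _ hi (by omega) h, hjl⟩
    · exact Or.inl (key0 _ _ hi (by omega) h)
  let F : V × V → ℝ := fun p => if G.Adj p.1 p.2 then (x p.1 + x p.2) ^ 2 else 0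
  have hF : energy G x = ∑ p : V × V, F p := by
    rw [Fintype.sum_prod_type]; rfl
  let P := (Finset.range c.length).image fun i => (g i, g (i + 1))
  let P' := (Finset.range c.length).image fun i => (g (i + 1), g i)
  have hadj : ∀ i < c.length, G.Adj (g i) (g (i + 1)) := fun i hi => c.adj_getVert_succ hi
  have sP : ∑ p ∈ P, F p = ∑ i ∈ Finset.range c.length, (x (g i) + x (g (i + 1))) ^ 2 := by
    rw [Finset.sum_image]
    · refine Finset.sum_congr rfl fun i hi => ?_
      simp only [F, if_pos (hadj i (Finset.mem_range.1 hi))]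
    · intro i hi j hj h
      simp only [Finset.coe_range, Set.mem_Iio] at hi hj
      exact key0 i j hi hj (Prod.ext_iff.1 h).1
  have sP' : ∑ p ∈ P', F p = ∑ i ∈ Finset.range c.length, (x (g i) + x (g (i + 1))) ^ 2 := by
    rw [Finset.sum_image]
    · refine Finset.sum_congr rfl fun i hi => ?_
      simp only [F, if_pos (hadj i (Finset.mem_range.1 hi)).symm]
      ring
    · intro i hi j hj h
      simp only [Finset.coe_range, Set.mem_Iio] at hi hj
      exact key0 i j hi hj (Prod.ext_iff.1 h).2
  have hdisj : Disjoint P P' := by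
    rw [Finset.disjoint_left]
    intro p hp hp'
    simp only [P, P', Finset.mem_image, Finset.mem_range] at hp hp'
    obtain ⟨i, hi, rfl⟩ := hp
    obtain ⟨j, hj, h⟩ := hp'
    obtain ⟨h1, h2⟩ := Prod.ext_iff.1 h
    have e1 := key2 i j hi hj h1.symm
    have e2 := key2 j i hj hi h2
    omega
  rw [hF, two_mul]
  nth_rewrite 1 [← sP]
  rw [← sP', ← Finset.sum_union hdisj]
  refine Finset.sum_le_sum_of_subset_of_nonneg (Finset.subset_univ _) fun p _ _ => ?_
  simp only [F]
  split_ifs <;> positivity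

theorem norm_bound {V : Type*} [Fintype V] (G : SimpleGraph V) (x : V → ℝ) {a : V}
    (hmax : ∀ v : V, |x v| ≤ |x a|)
    (c : G.Walk a a) (hc : c.IsCycle) :
    x ⬝ᵥ x ≤ ∑ i ∈ Finset.range c.length, x (c.getVert i) ^ 2
      + ((Fintype.card V : ℝ) - c.length) * x a ^ 2 := by
  have hL := hc.three_le_length
  have inj0 := hc.getVert_injOn'
  let P := (Finset.range c.length).image c.getVert
  have hinj : Set.InjOn c.getVert (Finset.range c.length) := by
    intro i hi j hj h
    simp only [Finset.coe_range, Set.mem_Iio] at hi hj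
    exact inj0 (show i ≤ c.length - 1 by omega) (show j ≤ c.length - 1 by omega) h
  have hcP : P.card = c.length := by
    rw [Finset.card_image_of_injOn hinj, Finset.card_range]
  have hs : ∑ p ∈ P, x p ^ 2 = ∑ i ∈ Finset.range c.length, x (c.getVert i) ^ 2 :=
    Finset.sum_image hinj
  have hs2 : ∑ p ∈ Pᶜ, x p ^ 2 ≤ (Pᶜ).card • x a ^ 2 :=
    Finset.sum_le_card_nsmul _ _ _ fun p _ => sq_le_sq.2 (hmax p)
  have hcc : ((Pᶜ).card : ℝ) = (Fintype.card V : ℝ) - c.length := by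
    rw [← hcP, ← Finset.card_add_card_compl P]; push_cast; ring
  rw [nsmul_eq_mul, hcc] at hs2
  have : x ⬝ᵥ x = ∑ p ∈ P, x p ^ 2 + ∑ p ∈ Pᶜ, x p ^ 2 := by
    rw [Finset.sum_add_sum_compl]
    simp only [dotProduct, sq]
  rw [this, hs]
  linarith

/-- Test vector on `Θ`, indexed by naturals. -/
noncomputable def tv (L : ℕ) (u : ℕ → ℝ) (j : ℕ) : ℝ :=
  if j ≤ 1 then - u 0 else (-1) ^ (j - 2 - L) * u (j - 2)

theorem tv_succ (L : ℕ) (u : ℕ → ℝ) (hu : ∀ i, L ≤ i → u i = u 0) (k : ℕ) :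
    tv L u (k + 2) + tv L u (k + 3) = if k < L then u k + u (k + 1) else 0 := by
  unfold tv
  rw [if_neg (by omega), if_neg (by omega)]
  have e1 : k + 2 - 2 = k := by omega
  have e2 : k + 3 - 2 = k + 1 := by omega
  rw [e1, e2]
  split_ifs with h
  · rw [Nat.sub_eq_zero_of_le (by omega : k ≤ L), Nat.sub_eq_zero_of_le (by omega : k + 1 ≤ L)]
    simp
  · rw [hu k (by omega), hu (k + 1) (by omega), Nat.succ_sub (by omega : L ≤ k), pow_succ]
    ring

theorem tv_last (n L : ℕ) (u : ℕ → ℝ) (hu : ∀ i, L ≤ i → u i = u 0) (hLn : L + 3 ≤ n)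
    (hn : Even n) (hL : Odd L) : tv L u (n - 1) = u 0 := by
  unfold tv
  rw [if_neg (by omega), hu _ (by omega), Even.neg_one_pow, one_mul]
  obtain ⟨a, rfl⟩ := hn
  obtain ⟨b, rfl⟩ := hL
  exact ⟨a - b - 2, by omega⟩

theorem tv_two (L : ℕ) (u : ℕ → ℝ) : tv L u 2 = u 0 := by
  simp [tv]

theorem tv_sq (L : ℕ) (u : ℕ → ℝ) (k : ℕ) : tv L u (k + 2) ^ 2 = u k ^ 2 := by
  unfold tv
  rw [if_neg (by omega), mul_pow, ← pow_mul, mul_comm _ 2, pow_mul]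
  simp

theorem tv_norm (n L : ℕ) (u : ℕ → ℝ) (hu : ∀ i, L ≤ i → u i = u 0) (hLn : L + 3 ≤ n) :
    ∑ i : Fin n, tv L u i * tv L u i
      = ∑ i ∈ Finset.range L, u i ^ 2 + ((n : ℝ) - L) * u 0 ^ 2 := by
  rw [Fin.sum_univ_eq_sum_range (fun i => tv L u i * tv L u i) n]
  obtain ⟨m, rfl⟩ : ∃ m, n = L + m + 2 := ⟨n - L - 2, by omega⟩
  rw [Finset.sum_range_succ', Finset.sum_range_succ']
  have : ∀ k, tv L u (k + 1 + 1) * tv L u (k + 1 + 1) = u k ^ 2 := fun k => by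
    rw [← tv_sq L u k]; ring
  simp only [this]
  rw [Finset.sum_range_add]
  have h2 : ∑ i ∈ Finset.range m, u (L + i) ^ 2 = m * u 0 ^ 2 := by
    rw [Finset.sum_congr rfl (fun i _ => by rw [hu (L + i) (by omega)]), Finset.sum_const,
      Finset.card_range, nsmul_eq_mul]
  rw [h2]
  simp only [tv]
  push_cast
  simp
  ring

theorem tv_energy (n L : ℕ) (u : ℕ → ℝ) (hu : ∀ i, L ≤ i → u i = u 0) (hLn : L + 3 ≤ n)
    (hn : Even n) (hL : Odd L) :
    energy (thetaG n) (fun i => tv L u i.val)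
      ≤ 2 * ∑ i ∈ Finset.range L, (u i + u (i + 1)) ^ 2 := by
  have h01 : tv L u 0 = - u 0 := by simp [tv]
  have h11 : tv L u 1 = - u 0 := by simp [tv]
  have hlast := tv_last n L u hu hLn hn hL
  have h2 := tv_two L u
  let R : ℕ → ℕ → ℝ := fun a b => if b = a + 1 ∧ 2 ≤ a ∧ a < L + 2
    then (tv L u a + tv L u b) ^ 2 else 0
  have Rnn : ∀ a b, 0 ≤ R a b := by
    intro a b; simp only [R]; split_ifs <;> positivity
  have relR : ∀ a b : ℕ, ((1 ≤ a ∧ b = a + 1) ∨ (a = 1 ∧ b = n - 1) ∨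
      (a = 0 ∧ (b = 2 ∨ b = n - 1))) → (tv L u a + tv L u b) ^ 2 ≤ R a b := by
    intro a b h
    by_cases hz : tv L u a + tv L u b = 0
    · rw [hz]; simpa using Rnn a b
    rcases h with ⟨h1, rfl⟩ | ⟨rfl, rfl⟩ | ⟨rfl, rfl | rfl⟩
    · by_cases ha : a = 1
      · subst ha; exfalso; apply hz; rw [h11, h2]; ring
      obtain ⟨k, rfl⟩ : ∃ k, a = k + 2 := ⟨a - 2, by omega⟩
      have := tv_succ L u hu k
      by_cases hk : k < L
      · simp only [R]
        rw [if_pos ⟨trivial, by omega, by omega⟩]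
      · rw [if_neg hk] at this
        exact absurd this hz
    · exfalso; apply hz; rw [h11, hlast]; ring
    · exfalso; apply hz; rw [h01, h2]; ring
    · exfalso; apply hz; rw [h01, hlast]; ring
  have step1 : energy (thetaG n) (fun i => tv L u i.val)
      ≤ ∑ a : Fin n, ∑ b : Fin n, (R a b + R b a) := by
    unfold energy
    refine Finset.sum_le_sum fun a _ => Finset.sum_le_sum fun b _ => ?_
    have n1 := Rnn a b
    have n2 := Rnn b a
    split_ifs with h
    · simp only [thetaG, thetaJK, SimpleGraph.fromRel_adj] at h
      rcases h.2 with h | h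
      · have := relR a b h
        linarith
      · have := relR b a h
        rw [add_comm (tv L u b)] at this
        linarith
    · linarith
  have step2 : ∑ a : Fin n, ∑ b : Fin n, (R a b + R b a)
      = 2 * ∑ a : Fin n, ∑ b : Fin n, R a b := by
    simp only [Finset.sum_add_distrib]
    rw [two_mul]
    congr 1
    exact Finset.sum_comm
  have step3 : ∑ a : Fin n, ∑ b : Fin n, R a b
      = ∑ i ∈ Finset.range L, (u i + u (i + 1)) ^ 2 := by
    have : ∀ a : Fin n, ∑ b : Fin n, R a b = ∑ b ∈ Finset.range n, R a b := fun a =>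
      Fin.sum_univ_eq_sum_range (fun b => R a b) n
    simp only [this]
    rw [Fin.sum_univ_eq_sum_range (fun a => ∑ b ∈ Finset.range n, R a b) n]
    have h4 : ∀ a ∈ Finset.range n, ∑ b ∈ Finset.range n, R a b
        = if 2 ≤ a ∧ a < L + 2 then (tv L u a + tv L u (a + 1)) ^ 2 else 0 := by
      intro a ha
      split_ifs with h
      · rw [Finset.sum_eq_single (a + 1)]
        · simp only [R]; rw [if_pos ⟨trivial, h⟩]
        · intro b _ hb
          simp only [R]; rw [if_neg (fun hh => hb hh.1)]
        · intro hh
          exfalso; apply hh; rw [Finset.mem_range]; omega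
      · refine Finset.sum_eq_zero fun b _ => ?_
        simp only [R]; rw [if_neg (fun hh => h hh.2)]
    rw [Finset.sum_congr rfl h4]
    obtain ⟨m, rfl⟩ : ∃ m, n = L + m + 2 := ⟨n - L - 2, by omega⟩
    rw [Finset.sum_range_succ', Finset.sum_range_succ', Finset.sum_range_add]
    have h5 : ∀ k ∈ Finset.range L, (if 2 ≤ k + 1 + 1 ∧ k + 1 + 1 < L + 2 then
        (tv L u (k + 1 + 1) + tv L u (k + 1 + 1 + 1)) ^ 2 else 0) = (u k + u (k + 1)) ^ 2 := by
      intro k hk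
      rw [Finset.mem_range] at hk
      rw [if_pos (by omega), tv_succ L u hu k, if_pos hk]
    rw [Finset.sum_congr rfl h5]
    simp
  rw [step2, step3] at step1
  exact step1

end Stmt11Aux

open Stmt11Aux

theorem stmt11 (n : ℕ) (hn : 4 ≤ n) (heven : Even n) {V : Type*} [Fintype V]
    (G : SimpleGraph V) (hcard : Fintype.card V = n)
    (h2 : TwoConnected G) (hnb : ¬ G.Colorable 2)
    (x : V → ℝ) (hx : x ≠ 0)
    (heig : (signlessLaplacian G).mulVec x = leastQEig G • x)
    (vμ : V) (hmax : ∀ v : V, |x v| ≤ |x vμ|)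
    {a : V} (c : G.Walk a a) (hc : c.IsCycle) (hcodd : Odd c.length)
    (hvμ : vμ ∈ c.support) (hlen : c.length + 3 ≤ n) :
    leastQEig (thetaG n) < leastQEig G := by
  obtain ⟨d, hd, hdl⟩ : ∃ d : G.Walk vμ vμ, d.IsCycle ∧ d.length = c.length :=
    ⟨c.rotate vμ hvμ, hc.rotate hvμ, by simp⟩
  rw [← hdl] at hcodd hlen
  have hx0 : x vμ ≠ 0 := by
    intro h0
    apply hx
    funext v
    have := hmax v
    rw [h0, abs_zero] at this
    exact abs_nonpos_iff.1 this
  let u : ℕ → ℝ := fun i => x (d.getVert i)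
  have hu0 : u 0 = x vμ := by simp [u]
  have hu : ∀ i, d.length ≤ i → u i = u 0 := by
    intro i hi
    rw [hu0]
    simp only [u]
    rw [d.getVert_of_length_le hi]
  let y : Fin n → ℝ := fun i => tv d.length u i.val
  have hE1 : energy (thetaG n) y ≤ energy G x :=
    (tv_energy n d.length u hu hlen heven hcodd).trans (cycle_energy G x d hd)
  have hS : x ⬝ᵥ x ≤ y ⬝ᵥ y := by
    have e := tv_norm n d.length u hu hlen
    have e2 := norm_bound G x hmax d hd
    rw [hcard] at e2
    have e3 : y ⬝ᵥ y = ∑ i : Fin n, tv d.length u i * tv d.length u i := rfl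
    rw [e3, e, hu0]
    exact e2
  have hq0 : 0 ≤ leastQEig G := eig_nonneg G x hx _ heig
  have hEx : energy G x = 2 * leastQEig G * (x ⬝ᵥ x) := by
    rw [← dot_mulVec, heig, dotProduct_smul, smul_eq_mul]; ring
  have hR := rayleigh (thetaG n) y
  have hxpos := dot_self_pos x hx
  by_contra hcon
  push Not at hcon
  have m1 : leastQEig G * (x ⬝ᵥ x) ≤ leastQEig G * (y ⬝ᵥ y) :=
    mul_le_mul_of_nonneg_left hS hq0
  have m2 : leastQEig G * (y ⬝ᵥ y) ≤ leastQEig (thetaG n) * (y ⬝ᵥ y) :=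
    mul_le_mul_of_nonneg_right hcon (hxpos.le.trans hS)
  have hev := rayleigh_eq (thetaG n) y (by linarith)
  have hone : 1 < n := by omega
  have hv1 := congrFun hev ⟨1, hone⟩
  have h11 : tv d.length u 1 = - u 0 := by simp [tv]
  rw [Stmt11Aux.mulVec_apply, Finset.sum_eq_zero] at hv1
  · have hy1 : y ⟨1, hone⟩ = - x vμ := by
      rw [← hu0]; exact h11
    rw [Pi.smul_apply, hy1, smul_eq_mul] at hv1
    have hz : leastQEig (thetaG n) = 0 := by
      rcases mul_eq_zero.1 hv1.symm with h | h
      · exact h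
      · exact absurd (neg_eq_zero.1 h) hx0
    have hEz : energy G x = 0 := by
      have := energy_nonneg G x
      rw [hz] at m2
      linarith
    have := walk_alt G x (energy_zero G x hEz) d
    rw [hcodd.neg_one_pow] at this
    apply hx0
    linarith
  · intro j _
    split_ifs with h
    · simp only [thetaG, thetaJK, SimpleGraph.fromRel_adj] at h
      have hj : j.val = 2 ∨ j.val = n - 1 := by omega
      change tv d.length u 1 + tv d.length u j.val = 0
      rw [h11]
      rcases hj with hj | hj
      · rw [hj, tv_two]; ring
      · rw [hj, tv_last n d.length u hu hlen heven hcodd]; ring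
    · rfl
end
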